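/- arXiv:2012.11999 — 5 statements merged into one kernel-verified Lean document; each statement's English description precedes it below -/
import Mathlib

section
/- Let d ≥ 2 and let F be a skew-symmetric endomorphism of Minkowski space 𝕄^{1,d-1}. Then F admits an F-invariant timelike plane (a 2-dimensional F-invariant subspace on which η is nondegenerate and which contains a timelike vector) if and only if there exist vectors e, v ∈ ℝ^d and μ ∈ ℝ with η(e,e) = -1, η(v,v) = 1, η(e,v) = 0, F e = μ v and F v = μ e. Moreover, for μ ≠ 0, such vectors e, v exist if and only if there exist linearly independent future-directed null vectors q₊, q₋ ∈ ℝ^d with F q₊ = μ q₊ and F q₋ = -μ q₋. -/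
open scoped BigOperators

/-- The Minkowski bilinear form on `ℝ^d`. -/
noncomputable def mink (d : ℕ) (x y : Fin d → ℝ) : ℝ :=
  ∑ i : Fin d, (if (i : ℕ) = 0 then (-1 : ℝ) else 1) * x i * y i

/-- Skew-symmetry w.r.t. the Minkowski form. -/
def IsSkew (d : ℕ) (F : (Fin d → ℝ) →ₗ[ℝ] (Fin d → ℝ)) : Prop :=
  ∀ x y, mink d (F x) y = - mink d x (F y)

theorem mink_comm (d : ℕ) (x y : Fin d → ℝ) : mink d x y = mink d y x :=
  Finset.sum_congr rfl fun _ _ => by ring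

theorem mink_add_left (d : ℕ) (x y z : Fin d → ℝ) :
    mink d (x + y) z = mink d x z + mink d y z := by
  simp only [mink, ← Finset.sum_add_distrib, Pi.add_apply]
  exact Finset.sum_congr rfl fun _ _ => by ring

theorem mink_smul_left (d : ℕ) (a : ℝ) (x z : Fin d → ℝ) :
    mink d (a • x) z = a * mink d x z := by
  simp only [mink, Finset.mul_sum, Pi.smul_apply, smul_eq_mul]
  exact Finset.sum_congr rfl fun _ _ => by ring

theorem mink_add_right (d : ℕ) (x y z : Fin d → ℝ) :
    mink d z (x + y) = mink d z x + mink d z y := by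
  simp only [mink_comm d z, mink_add_left]

theorem mink_smul_right (d : ℕ) (a : ℝ) (x z : Fin d → ℝ) :
    mink d z (a • x) = a * mink d z x := by
  simp only [mink_comm d z, mink_smul_left]

theorem mink_zero_left (d : ℕ) (z : Fin d → ℝ) : mink d 0 z = 0 := by
  simp [mink]

theorem mink_neg_left (d : ℕ) (x z : Fin d → ℝ) : mink d (-x) z = -mink d x z := by
  simp [mink]

theorem mink_neg_right (d : ℕ) (x z : Fin d → ℝ) : mink d z (-x) = -mink d z x := by
  simp [mink]

theorem mink_sub_left (d : ℕ) (x y z : Fin d → ℝ) :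
    mink d (x - y) z = mink d x z - mink d y z := by
  rw [sub_eq_add_neg, mink_add_left, mink_neg_left, sub_eq_add_neg]

theorem mink_sub_right (d : ℕ) (x y z : Fin d → ℝ) :
    mink d z (x - y) = mink d z x - mink d z y := by
  simp only [mink_comm d z, mink_sub_left]

/-- The Minkowski form is positive definite on vectors with vanishing time component. -/
theorem eq_zero_of_time_eq_zero {d : ℕ} (hd : 0 < d) {x : Fin d → ℝ}
    (h0 : x ⟨0, hd⟩ = 0) (hx : mink d x x ≤ 0) : x = 0 := by
  have hnn : ∀ i ∈ (Finset.univ : Finset (Fin d)),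
      0 ≤ (if (i : ℕ) = 0 then (-1 : ℝ) else 1) * x i * x i := by
    intro i _
    split_ifs with h
    · rw [show i = ⟨0, hd⟩ from Fin.ext h, h0]; simp
    · nlinarith [mul_self_nonneg (x i)]
  have hs := (Finset.sum_eq_zero_iff_of_nonneg hnn).1 (le_antisymm hx (Finset.sum_nonneg hnn))
  funext i
  by_cases h : (i : ℕ) = 0
  · rw [show i = ⟨0, hd⟩ from Fin.ext h, h0]; rfl
  · simpa [h] using hs i (Finset.mem_univ i)

/-- The combination of `x` and `y` whose time component vanishes is zero as soon as its
Minkowski square is nonpositive. -/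
theorem time_smul_sub_eq_zero {d : ℕ} (hd : 0 < d) {x y : Fin d → ℝ}
    (h : y ⟨0, hd⟩ ^ 2 * mink d x x - 2 * y ⟨0, hd⟩ * x ⟨0, hd⟩ * mink d x y
      + x ⟨0, hd⟩ ^ 2 * mink d y y ≤ 0) :
    y ⟨0, hd⟩ • x - x ⟨0, hd⟩ • y = 0 := by
  apply eq_zero_of_time_eq_zero hd
  · simp only [Pi.sub_apply, Pi.smul_apply, smul_eq_mul]; ring
  · simp only [mink_sub_left, mink_sub_right, mink_smul_left, mink_smul_right, mink_comm d y x]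
    linarith

/-- A nonzero vector orthogonal to a timelike vector is spacelike. -/
theorem mink_self_pos_of_orthogonal {d : ℕ} (hd : 0 < d) {e y : Fin d → ℝ}
    (he : mink d e e < 0) (hey : mink d e y = 0) (hy : y ≠ 0) : 0 < mink d y y := by
  by_contra! hle
  have hw := time_smul_sub_eq_zero hd (x := e) (y := y) (by
    rw [hey]
    nlinarith [mul_nonneg (sq_nonneg (y ⟨0, hd⟩)) (neg_nonneg.2 he.le),
      mul_nonneg (sq_nonneg (e ⟨0, hd⟩)) (neg_nonneg.2 hle)])
  have h := congrArg (fun z => mink d e z) hw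
  simp only [mink_sub_right, mink_smul_right, hey, mink_comm d e 0, mink_zero_left] at h
  have hy0 : y ⟨0, hd⟩ = 0 := by
    have h' : y ⟨0, hd⟩ * mink d e e = 0 := by linarith
    exact (mul_eq_zero.1 h').resolve_right he.ne
  exact hy (eq_zero_of_time_eq_zero hd hy0 hle)

theorem time_ne_zero_of_timelike {d : ℕ} (hd : 0 < d) {e : Fin d → ℝ}
    (he : mink d e e < 0) : e ⟨0, hd⟩ ≠ 0 := by
  intro h
  have := eq_zero_of_time_eq_zero hd h he.le
  rw [this, mink_zero_left] at he
  exact he.false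

/-- A causal vector with negative product with a future-directed timelike vector is
future directed. -/
theorem time_pos_of_mink_neg {d : ℕ} (hd : 0 < d) {e q : Fin d → ℝ}
    (he : mink d e e < 0) (he0 : 0 < e ⟨0, hd⟩) (hq : mink d q q ≤ 0)
    (heq : mink d e q < 0) : 0 < q ⟨0, hd⟩ := by
  by_contra! hle
  have hw := time_smul_sub_eq_zero hd (x := e) (y := q) (by
    nlinarith [mul_nonneg (sq_nonneg (q ⟨0, hd⟩)) (neg_nonneg.2 he.le),
      mul_nonneg (sq_nonneg (e ⟨0, hd⟩)) (neg_nonneg.2 hq),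
      mul_nonneg (mul_nonneg (neg_nonneg.2 hle) he0.le) (neg_nonneg.2 heq.le)])
  have h := congrArg (fun z => mink d e z) hw
  simp only [mink_sub_right, mink_smul_right, mink_comm d e 0, mink_zero_left] at h
  nlinarith [mul_nonneg (neg_nonneg.2 hle) (neg_nonneg.2 he.le), mul_pos he0 (neg_pos.2 heq)]

/-- Linearly independent future-directed null vectors have negative Minkowski product. -/
theorem mink_neg_of_null {d : ℕ} (hd : 0 < d) {p q : Fin d → ℝ}
    (hpq : LinearIndependent ℝ ![p, q]) (hp : mink d p p = 0) (hq : mink d q q = 0)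
    (hp0 : 0 < p ⟨0, hd⟩) (hq0 : 0 < q ⟨0, hd⟩) : mink d p q < 0 := by
  by_contra! hle
  have hw := time_smul_sub_eq_zero hd (x := p) (y := q) (by
    rw [hp, hq]
    nlinarith [mul_nonneg (mul_pos hq0 hp0).le hle])
  have := (LinearIndependent.pair_iff.1 hpq (q ⟨0, hd⟩) (-p ⟨0, hd⟩)
    (by rw [neg_smul, ← sub_eq_add_neg, hw])).1
  exact hq0.ne' this

theorem linearIndependent_of_orthonormal {d : ℕ} {e v : Fin d → ℝ}
    (he : mink d e e = -1) (hv : mink d v v = 1) (hev : mink d e v = 0) :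
    LinearIndependent ℝ ![e, v] := by
  refine LinearIndependent.pair_iff.2 fun a b h => ?_
  have h1 := congrArg (fun z => mink d z e) h
  have h2 := congrArg (fun z => mink d z v) h
  simp only [mink_add_left, mink_smul_left, mink_zero_left, mink_comm d v e, he, hv, hev] at h1 h2
  constructor <;> linarith

theorem finrank_span_pair_of_linearIndependent {V : Type*} [AddCommGroup V] [Module ℝ V]
    {x y : V} (h : LinearIndependent ℝ ![x, y]) :
    Module.finrank ℝ (Submodule.span ℝ ({x, y} : Set V)) = 2 := by
  rw [← Matrix.range_cons_cons_empty x y ![], finrank_span_eq_card h, Fintype.card_fin]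

theorem IsSkew.mink_map_self {d : ℕ} {F : (Fin d → ℝ) →ₗ[ℝ] (Fin d → ℝ)} (hF : IsSkew d F)
    (x : Fin d → ℝ) : mink d (F x) x = 0 := by
  have := hF x x
  rw [mink_comm d x] at this
  linarith

/-- A plane containing a timelike vector has an orthonormal basis. -/
theorem exists_orthonormal_of_timelike_plane {d : ℕ} (hd : 0 < d)
    {P : Submodule ℝ (Fin d → ℝ)} (hP : Module.finrank ℝ P = 2)
    {x : Fin d → ℝ} (hxP : x ∈ P) (hx : mink d x x < 0) :
    ∃ e v : Fin d → ℝ, mink d e e = -1 ∧ mink d v v = 1 ∧ mink d e v = 0 ∧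
      Submodule.span ℝ {e, v} = P := by
  obtain ⟨y, hyP, hy⟩ : ∃ y ∈ P, y ∉ Submodule.span ℝ {x} := by
    by_contra! h
    have h1 := Submodule.finrank_mono (R := ℝ) (show P ≤ Submodule.span ℝ {x} from h)
    have h2 := finrank_span_le_card (R := ℝ) ({x} : Set (Fin d → ℝ))
    simp only [Set.toFinset_singleton, Finset.card_singleton] at h2
    omega
  set w := y - (mink d x y / mink d x x) • x with hw
  have hwP : w ∈ P := P.sub_mem hyP (P.smul_mem _ hxP)
  have hxw : mink d x w = 0 := by
    rw [hw, mink_sub_right, mink_smul_right, div_mul_cancel₀ _ hx.ne, sub_self]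
  have hw0 : w ≠ 0 := fun h =>
    hy (Submodule.mem_span_singleton.2 ⟨_, (sub_eq_zero.1 h).symm⟩)
  have hww := mink_self_pos_of_orthogonal hd hx hxw hw0
  have hs : √(-mink d x x) ^ 2 = -mink d x x := Real.sq_sqrt (by linarith)
  have ht : √(mink d w w) ^ 2 = mink d w w := Real.sq_sqrt hww.le
  have hs0 : √(-mink d x x) ≠ 0 := (Real.sqrt_pos.2 (by linarith)).ne'
  have ht0 : √(mink d w w) ≠ 0 := (Real.sqrt_pos.2 hww).ne'
  have he : mink d ((√(-mink d x x))⁻¹ • x) ((√(-mink d x x))⁻¹ • x) = -1 := by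
    rw [mink_smul_left, mink_smul_right]
    field_simp
    linarith
  have hv : mink d ((√(mink d w w))⁻¹ • w) ((√(mink d w w))⁻¹ • w) = 1 := by
    rw [mink_smul_left, mink_smul_right]
    field_simp
    linarith
  have hev : mink d ((√(-mink d x x))⁻¹ • x) ((√(mink d w w))⁻¹ • w) = 0 := by
    rw [mink_smul_left, mink_smul_right, hxw]
    ring
  refine ⟨_, _, he, hv, hev, Submodule.eq_of_le_of_finrank_eq ?_ ?_⟩
  · rw [Submodule.span_le, Set.insert_subset_iff, Set.singleton_subset_iff]
    exact ⟨P.smul_mem _ hxP, P.smul_mem _ hwP⟩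
  · rw [hP]
    exact finrank_span_pair_of_linearIndependent (linearIndependent_of_orthonormal he hv hev)

/-- A skew-symmetric map preserving the span of an orthonormal pair acts on it as a boost
generator. -/
theorem IsSkew.exists_boost {d : ℕ} {F : (Fin d → ℝ) →ₗ[ℝ] (Fin d → ℝ)} (hF : IsSkew d F)
    {e v : Fin d → ℝ} (he : mink d e e = -1) (hv : mink d v v = 1) (hev : mink d e v = 0)
    (hFe : F e ∈ Submodule.span ℝ {e, v}) (hFv : F v ∈ Submodule.span ℝ {e, v}) :
    ∃ μ : ℝ, F e = μ • v ∧ F v = μ • e := by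
  obtain ⟨a, b, hab⟩ := Submodule.mem_span_pair.1 hFe
  obtain ⟨r, s, hrs⟩ := Submodule.mem_span_pair.1 hFv
  have h1 := hF.mink_map_self e
  have h2 := hF.mink_map_self v
  have h3 := hF e v
  rw [← hab] at h1 h3
  rw [← hrs] at h2 h3
  simp only [mink_add_left, mink_smul_left, mink_add_right, mink_smul_right, mink_comm d v e,
    he, hv, hev] at h1 h2 h3
  have ha : a = 0 := by linarith
  have hs : s = 0 := by linarith
  have hr : r = b := by linarith
  refine ⟨b, ?_, ?_⟩
  · rw [← hab, ha, zero_smul, zero_add]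
  · rw [← hrs, hs, hr, zero_smul, add_zero]

/-- The span of an orthonormal pair on which `F` acts as a boost generator is an `F`-invariant
timelike plane. -/
theorem exists_timelike_plane_of_boost {d : ℕ} {F : (Fin d → ℝ) →ₗ[ℝ] (Fin d → ℝ)}
    {e v : Fin d → ℝ} {μ : ℝ} (he : mink d e e = -1) (hv : mink d v v = 1)
    (hev : mink d e v = 0) (hFe : F e = μ • v) (hFv : F v = μ • e) :
    ∃ P : Submodule ℝ (Fin d → ℝ),
      Module.finrank ℝ P = 2 ∧ (∀ x ∈ P, F x ∈ P) ∧
      (∀ x ∈ P, (∀ y ∈ P, mink d x y = 0) → x = 0) ∧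
      (∃ x ∈ P, mink d x x < 0) := by
  have heP : e ∈ Submodule.span ℝ {e, v} := Submodule.subset_span (by simp)
  have hvP : v ∈ Submodule.span ℝ {e, v} := Submodule.subset_span (by simp)
  refine ⟨Submodule.span ℝ {e, v}, finrank_span_pair_of_linearIndependent
    (linearIndependent_of_orthonormal he hv hev), ?_, ?_, e, heP, by linarith⟩
  · intro x hx
    obtain ⟨a, b, rfl⟩ := Submodule.mem_span_pair.1 hx
    rw [map_add, map_smul, map_smul, hFe, hFv]
    exact add_mem (Submodule.smul_mem _ _ (Submodule.smul_mem _ _ hvP))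
      (Submodule.smul_mem _ _ (Submodule.smul_mem _ _ heP))
  · intro x hx h
    obtain ⟨a, b, rfl⟩ := Submodule.mem_span_pair.1 hx
    have h1 := h e heP
    have h2 := h v hvP
    simp only [mink_add_left, mink_smul_left, mink_comm d v e, he, hv, hev] at h1 h2
    rw [show a = 0 by linarith, show b = 0 by linarith, zero_smul, zero_smul, add_zero]

theorem exists_null_of_boost {d : ℕ} (hd : 0 < d) {F : (Fin d → ℝ) →ₗ[ℝ] (Fin d → ℝ)}
    {e v : Fin d → ℝ} {μ : ℝ} (he : mink d e e = -1) (hv : mink d v v = 1)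
    (hev : mink d e v = 0) (hFe : F e = μ • v) (hFv : F v = μ • e) :
    ∃ qp qm : Fin d → ℝ, LinearIndependent ℝ ![qp, qm] ∧
      mink d qp qp = 0 ∧ mink d qm qm = 0 ∧ 0 < qp ⟨0, hd⟩ ∧ 0 < qm ⟨0, hd⟩ ∧
      F qp = μ • qp ∧ F qm = (-μ) • qm := by
  wlog he0 : 0 < e ⟨0, hd⟩ generalizing e v
  · have hne := time_ne_zero_of_timelike hd (show mink d e e < 0 by linarith)
    refine this (e := -e) (v := -v) ?_ ?_ ?_ ?_ ?_ ?_
    · simpa [mink_neg_left, mink_neg_right] using he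
    · simpa [mink_neg_left, mink_neg_right] using hv
    · simpa [mink_neg_left, mink_neg_right] using hev
    · simp [hFe]
    · simp [hFv]
    · simpa using lt_of_le_of_ne (not_lt.1 he0) hne
  have hp : mink d (e + v) (e + v) = 0 := by
    simp only [mink_add_left, mink_add_right, mink_comm d v e, he, hv, hev]; norm_num
  have hm : mink d (e - v) (e - v) = 0 := by
    simp only [mink_sub_left, mink_sub_right, mink_comm d v e, he, hv, hev]; norm_num
  refine ⟨e + v, e - v, ?_, hp, hm, ?_, ?_, ?_, ?_⟩
  · refine LinearIndependent.pair_iff.2 fun a b h => ?_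
    have := LinearIndependent.pair_iff.1 (linearIndependent_of_orthonormal he hv hev)
      (a + b) (a - b) (by rw [← h]; module)
    constructor <;> linarith [this.1, this.2]
  · refine time_pos_of_mink_neg hd (by linarith) he0 hp.le ?_
    rw [mink_add_right]; linarith
  · refine time_pos_of_mink_neg hd (by linarith) he0 hm.le ?_
    rw [mink_sub_right]; linarith
  · rw [map_add, hFe, hFv]; module
  · rw [map_sub, hFe, hFv]; module

theorem exists_boost_of_null {d : ℕ} (hd : 0 < d) {F : (Fin d → ℝ) →ₗ[ℝ] (Fin d → ℝ)}
    {p q : Fin d → ℝ} {μ : ℝ} (hpq : LinearIndependent ℝ ![p, q])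
    (hp : mink d p p = 0) (hq : mink d q q = 0)
    (hp0 : 0 < p ⟨0, hd⟩) (hq0 : 0 < q ⟨0, hd⟩)
    (hFp : F p = μ • p) (hFq : F q = (-μ) • q) :
    ∃ e v : Fin d → ℝ, mink d e e = -1 ∧ mink d v v = 1 ∧ mink d e v = 0 ∧
      F e = μ • v ∧ F v = μ • e := by
  have hc := (mink_neg_of_null hd hpq hp hq hp0 hq0).ne
  refine ⟨(1 / 2 : ℝ) • p + (-1 / mink d p q) • q, (1 / 2 : ℝ) • p - (-1 / mink d p q) • q,
    ?_, ?_, ?_, ?_, ?_⟩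
  iterate 3
    simp only [mink_add_left, mink_add_right, mink_sub_left, mink_sub_right, mink_smul_left,
      mink_smul_right, mink_comm d q p, hp, hq]
    field_simp
    ring
  · rw [map_add, map_smul, map_smul, hFp, hFq]; module
  · rw [map_sub, map_smul, map_smul, hFp, hFq]; module

/-- A skew-symmetric endomorphism admits an `F`-invariant timelike plane iff
there are orthogonal vectors `e` (unit timelike) and `v` (unit spacelike) with
`F e = μ v`, `F v = μ e`; moreover for `μ ≠ 0` such `e, v` exist iff there are
linearly independent future-directed null eigenvectors `q₊, q₋` with
eigenvalues `μ, -μ`. -/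
theorem stmt1 (d : ℕ) (hd : 2 ≤ d)
    (F : (Fin d → ℝ) →ₗ[ℝ] (Fin d → ℝ)) (hF : IsSkew d F) :
    ((∃ P : Submodule ℝ (Fin d → ℝ),
        Module.finrank ℝ P = 2 ∧ (∀ x ∈ P, F x ∈ P) ∧
        (∀ x ∈ P, (∀ y ∈ P, mink d x y = 0) → x = 0) ∧
        (∃ x ∈ P, mink d x x < 0)) ↔
      (∃ (e v : Fin d → ℝ) (μ : ℝ),
        mink d e e = -1 ∧ mink d v v = 1 ∧ mink d e v = 0 ∧
        F e = μ • v ∧ F v = μ • e)) ∧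
    (∀ μ : ℝ, μ ≠ 0 →
      ((∃ e v : Fin d → ℝ,
          mink d e e = -1 ∧ mink d v v = 1 ∧ mink d e v = 0 ∧
          F e = μ • v ∧ F v = μ • e) ↔
        (∃ qp qm : Fin d → ℝ, LinearIndependent ℝ ![qp, qm] ∧
          mink d qp qp = 0 ∧ mink d qm qm = 0 ∧
          0 < qp ⟨0, by omega⟩ ∧ 0 < qm ⟨0, by omega⟩ ∧
          F qp = μ • qp ∧ F qm = (-μ) • qm))) := by
  have hd0 : 0 < d := by omega
  refine ⟨⟨?_, ?_⟩, fun μ _ => ⟨?_, ?_⟩⟩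
  · rintro ⟨P, hP, hFP, -, x, hxP, hx⟩
    obtain ⟨e, v, he, hv, hev, rfl⟩ := exists_orthonormal_of_timelike_plane hd0 hP hxP hx
    obtain ⟨μ, h⟩ := hF.exists_boost he hv hev (hFP e (Submodule.subset_span (by simp)))
      (hFP v (Submodule.subset_span (by simp)))
    exact ⟨e, v, μ, he, hv, hev, h⟩
  · rintro ⟨e, v, μ, he, hv, hev, hFe, hFv⟩
    exact exists_timelike_plane_of_boost he hv hev hFe hFv
  · rintro ⟨e, v, he, hv, hev, hFe, hFv⟩
    exact exists_null_of_boost hd0 he hv hev hFe hFv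
  · rintro ⟨p, q, hpq, hp, hq, hp0, hq0, hFp, hFq⟩
    exact exists_boost_of_null hd0 hpq hp hq hp0 hq0 hFp hFq
end

section
/- Let d ≥ 4 and let F be a skew-symmetric endomorphism of Minkowski space 𝕄^{1,d-1}. If F has a null eigenvector (a nonzero null vector k with F k = λ k for some λ ∈ ℝ), then either F has a spacelike eigenvector (a spacelike vector e with F e = 0) or F has a spacelike eigenplane, i.e. there exist u, v and μ ∈ ℝ with η(u,u) = η(v,v) = 1, η(u,v) = 0, F u = μ v and F v = -μ u. -/
open scoped BigOperators

/-- A skew endomorphism of a finite-dimensional Euclidean space vanishes or its square has a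
negative eigenvalue. -/
theorem eq_zero_or_exists_sq_eigenvector_of_skew {V : Type*} [AddCommGroup V] [Module ℝ V]
    [FiniteDimensional ℝ V] (B : V →ₗ[ℝ] V →ₗ[ℝ] ℝ) (hsymm : ∀ x y, B x y = B y x)
    (hpos : ∀ x, x ≠ 0 → 0 < B x x) (A : V →ₗ[ℝ] V) (hA : ∀ x y, B (A x) y = -B x (A y)) :
    A = 0 ∨ ∃ (x : V) (c : ℝ), x ≠ 0 ∧ c < 0 ∧ A (A x) = c • x := by
  have hnonneg : ∀ x, 0 ≤ B x x := fun x => by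
    rcases eq_or_ne x 0 with rfl | hx
    · simp
    · exact (hpos x hx).le
  let core : InnerProductSpace.Core ℝ V :=
    { inner := fun x y => B x y
      conj_inner_symm := fun x y => by simpa using hsymm y x
      re_inner_nonneg := fun x => by simpa using hnonneg x
      add_left := fun x y z => by simp
      smul_left := fun x y r => by simp
      definite := fun x hx => by
        by_contra h
        exact (hpos x h).ne' hx }
  let _ : NormedAddCommGroup V := core.toNormedAddCommGroup
  let _ : InnerProductSpace ℝ V := InnerProductSpace.ofCore core.toCore
  have hT : (A ∘ₗ A).IsSymmetric := fun x y => by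
    change B (A (A x)) y = B x (A (A y))
    rw [hA, hA, neg_neg]
  by_cases h : ∀ i, hT.eigenvalues rfl i = 0
  · left
    have h0 : A ∘ₗ A = 0 := by
      refine (hT.eigenvectorBasis rfl).toBasis.ext fun i => ?_
      simp [-LinearMap.coe_comp, hT.apply_eigenvectorBasis, h]
    ext x
    by_contra hx
    have h1 : A (A x) = 0 := LinearMap.congr_fun h0 x
    have h2 := hpos _ hx
    rw [hA, h1] at h2
    simp at h2
  · right
    push Not at h
    obtain ⟨i, hi⟩ := h
    set x := hT.eigenvectorBasis rfl i
    have hx : x ≠ 0 := by simpa using (hT.eigenvectorBasis rfl).toBasis.ne_zero i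
    have hc : A (A x) = hT.eigenvalues rfl i • x := hT.apply_eigenvectorBasis rfl i
    refine ⟨x, hT.eigenvalues rfl i, hx, lt_of_le_of_ne ?_ hi, hc⟩
    have h1 := hnonneg (A x)
    rw [hA, hc, map_smul, smul_eq_mul] at h1
    have h2 := hpos x hx
    by_contra! h3
    nlinarith [mul_pos h3 h2]

/-- A spacelike eigenvector of `F ∘ F` with negative eigenvalue spans a spacelike eigenplane of a
skew endomorphism `F`. -/
theorem exists_eigenplane_of_sq_eigenvector {V : Type*} [AddCommGroup V] [Module ℝ V]
    (B : V →ₗ[ℝ] V →ₗ[ℝ] ℝ) (hsymm : ∀ x y, B x y = B y x) (F : V →ₗ[ℝ] V)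
    (hF : ∀ x y, B (F x) y = -B x (F y)) {w : V} {c : ℝ} (hw : 0 < B w w) (hc : c < 0)
    (hFw : F (F w) = c • w) :
    ∃ (u v : V) (μ : ℝ), B u u = 1 ∧ B v v = 1 ∧ B u v = 0 ∧ F u = μ • v ∧ F v = (-μ) • u := by
  obtain ⟨n, hn, hnw⟩ : ∃ n : ℝ, 0 < n ∧ n * n = B w w :=
    ⟨√(B w w), Real.sqrt_pos.2 hw, Real.mul_self_sqrt hw.le⟩
  obtain ⟨μ, hμ, hμc⟩ : ∃ μ : ℝ, 0 < μ ∧ μ * μ = -c :=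
    ⟨√(-c), Real.sqrt_pos.2 (by linarith), Real.mul_self_sqrt (by linarith)⟩
  obtain rfl : c = -(μ * μ) := by linarith
  have h0 : B w (F w) = 0 := by
    have h1 := hF w w
    rw [hsymm] at h1
    linarith
  refine ⟨n⁻¹ • w, (μ⁻¹ * n⁻¹) • F w, μ, ?_, ?_, ?_, ?_, ?_⟩
  · simp only [map_smul, LinearMap.smul_apply, smul_eq_mul, ← hnw]
    field_simp
  · simp only [map_smul, LinearMap.smul_apply, smul_eq_mul, hF, hFw, ← hnw]
    field_simp
  · simp [h0]
  · rw [map_smul, smul_smul, mul_inv_cancel_left₀ hμ.ne']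
  · rw [map_smul, hFw, smul_smul, smul_smul]
    congr 1
    field_simp

/-- The Minkowski form as a bilinear map. -/
noncomputable def minkForm (d : ℕ) : (Fin d → ℝ) →ₗ[ℝ] (Fin d → ℝ) →ₗ[ℝ] ℝ :=
  LinearMap.mk₂ ℝ (mink d)
    (fun x y z => by simp [mink, mul_add, add_mul, Finset.sum_add_distrib])
    (fun c x y => by
      simp only [mink, Finset.mul_sum, smul_eq_mul, Pi.smul_apply]
      exact Finset.sum_congr rfl fun i _ => by ring)
    (fun x y z => by simp [mink, mul_add, Finset.sum_add_distrib])
    (fun c x y => by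
      simp only [mink, Finset.mul_sum, smul_eq_mul, Pi.smul_apply]
      exact Finset.sum_congr rfl fun i _ => by ring)

theorem minkForm_apply (d : ℕ) (x y : Fin d → ℝ) : minkForm d x y = mink d x y := rfl

theorem minkForm_comm (d : ℕ) (x y : Fin d → ℝ) : minkForm d x y = minkForm d y x := by
  simp only [minkForm_apply, mink]
  exact Finset.sum_congr rfl fun i _ => by ring

theorem minkForm_self_pos {d : ℕ} [NeZero d] {x : Fin d → ℝ} (hx0 : x 0 = 0) (hx : x ≠ 0) :
    0 < minkForm d x x := by
  have hterm : ∀ i : Fin d, (if (i : ℕ) = 0 then (-1 : ℝ) else 1) * x i * x i = x i * x i := by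
    intro i
    split_ifs with h
    · have hi : i = 0 := Fin.ext (by simpa using h)
      simp [hi, hx0]
    · ring
  obtain ⟨i, hi⟩ := Function.ne_iff.1 hx
  rw [minkForm_apply, mink, Finset.sum_congr rfl fun i _ => hterm i]
  exact Finset.sum_pos' (fun j _ => mul_self_nonneg _)
    ⟨i, Finset.mem_univ i, mul_self_pos.2 hi⟩

/-- Three linear functionals on a space of dimension at least four have a common nonzero zero. -/
theorem exists_ne_zero_of_three_functionals {d : ℕ} (hd : 4 ≤ d)
    (f g h : (Fin d → ℝ) →ₗ[ℝ] ℝ) : ∃ x, x ≠ 0 ∧ f x = 0 ∧ g x = 0 ∧ h x = 0 := by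
  have hker := LinearMap.ker_ne_bot_of_finrank_lt (f := f.prod (g.prod h))
    (by simp; omega)
  obtain ⟨x, hx, hx0⟩ := Submodule.exists_mem_ne_zero_of_ne_bot hker
  simp only [LinearMap.mem_ker, LinearMap.prod_apply, Function.prod_apply, Prod.mk_eq_zero] at hx
  exact ⟨x, hx0, hx.1, hx.2.1, hx.2.2⟩

/-- If a skew-symmetric endomorphism of `𝕄^{1,d-1}` (`d ≥ 4`) has a null
eigenvector, then it has a spacelike eigenvector (with zero eigenvalue)
or a spacelike eigenplane. -/
theorem stmt4 (d : ℕ) (hd : 4 ≤ d)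
    (F : (Fin d → ℝ) →ₗ[ℝ] (Fin d → ℝ)) (hF : IsSkew d F)
    (hnull : ∃ (k : Fin d → ℝ) (lam : ℝ), k ≠ 0 ∧ mink d k k = 0 ∧ F k = lam • k) :
    (∃ e : Fin d → ℝ, 0 < mink d e e ∧ F e = 0) ∨
    (∃ (u v : Fin d → ℝ) (μ : ℝ),
      mink d u u = 1 ∧ mink d v v = 1 ∧ mink d u v = 0 ∧
      F u = μ • v ∧ F v = (-μ) • u) := by
  have : NeZero d := ⟨by omega⟩
  obtain ⟨k, lam, hk, hkk, hFk⟩ := hnull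
  set B := minkForm d
  have hsymm : ∀ x y, B x y = B y x := minkForm_comm d
  have hskew : ∀ x y, B (F x) y = -B x (F y) := hF
  have hBkk : B k k = 0 := hkk
  have hk0 : k 0 ≠ 0 := fun h => (minkForm_self_pos h hk).ne' hkk
  let time : (Fin d → ℝ) →ₗ[ℝ] ℝ := LinearMap.proj 0
  let S : Submodule ℝ (Fin d → ℝ) := LinearMap.ker time ⊓ LinearMap.ker (B k)
  have memS : ∀ x, x ∈ S ↔ x 0 = 0 ∧ B k x = 0 := fun x => Iff.rfl
  let A₀ : (Fin d → ℝ) →ₗ[ℝ] (Fin d → ℝ) := F - ((k 0)⁻¹ • (time ∘ₗ F)).smulRight k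
  have A₀_apply : ∀ x, A₀ x = F x - ((k 0)⁻¹ * F x 0) • k := fun x => rfl
  have hA₀ : ∀ x ∈ S, A₀ x ∈ S := by
    intro x hx
    rw [memS] at hx ⊢
    constructor
    · simp [A₀_apply]
      field_simp
      simp
    · have h1 := hskew k x
      rw [hFk, map_smul, LinearMap.smul_apply, hx.2] at h1
      rw [A₀_apply, map_sub, map_smul, hBkk]
      simp at h1 ⊢
      exact h1
  have hA : ∀ x y : S, B (A₀ x) y = -B x (A₀ y) := by
    intro x y
    have hx := ((memS x).1 x.2).2
    have hy := ((memS y).1 y.2).2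
    rw [A₀_apply, A₀_apply, map_sub, map_sub, LinearMap.sub_apply, map_smul, map_smul,
      LinearMap.smul_apply, hy, hsymm x k, hx, hskew]
    simp
  have hposS : ∀ x : S, x ≠ 0 → 0 < B x x := fun x hx =>
    minkForm_self_pos ((memS x).1 x.2).1 (by simpa using hx)
  rcases eq_zero_or_exists_sq_eigenvector_of_skew (B.compl₁₂ S.subtype S.subtype)
    (fun x y => hsymm x y) hposS (A₀.restrict hA₀) hA with h0 | ⟨⟨x, hxS⟩, c, hx, hc, hxc⟩
  · left
    obtain ⟨x, hx, hx0, hxk, hFx⟩ := exists_ne_zero_of_three_functionals hd time (B k) (time ∘ₗ F)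
    refine ⟨x, minkForm_self_pos hx0 hx, ?_⟩
    have h1 : A₀ x = 0 := congrArg Subtype.val (LinearMap.congr_fun h0 ⟨x, hx0, hxk⟩)
    have h2 : F x 0 = 0 := hFx
    rwa [A₀_apply, h2, mul_zero, zero_smul, sub_zero] at h1
  · right
    have hxx : 0 < B x x := hposS _ hx
    have hkx : B k x = 0 := hxS.2
    have hAA : A₀ (A₀ x) = c • x := congrArg Subtype.val hxc
    obtain ⟨e, he⟩ : ∃ e : ℝ, F (F x) = c • x + e • k := by
      rw [A₀_apply (A₀ x), sub_eq_iff_eq_add, A₀_apply x, map_sub, map_smul, hFk,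
        sub_eq_iff_eq_add, smul_smul, add_assoc, ← add_smul] at hAA
      exact ⟨_, hAA⟩
    have hne : c - lam * lam ≠ 0 := by nlinarith [mul_self_nonneg lam]
    refine exists_eigenplane_of_sq_eigenvector B hsymm F hskew
      (w := x + (e / (c - lam * lam)) • k) ?_ hc ?_
    · simpa [hsymm x k, hkx, hBkk] using hxx
    · simp only [map_add, map_smul, he, hFk, smul_add, smul_smul]
      rw [add_assoc, ← add_smul]
      congr 2
      linear_combination -(div_mul_cancel₀ e hne)
end

section
/- Let d ≥ 3, set p := ⌊(d-1)/2⌋ - 1, and let F be a skew-symmetric endomorphism of Minkowski space 𝕄^{1,d-1}. Then there exist 2-dimensional F-invariant subspaces Π₁, …, Π_p of ℝ^d on each of which η is positive definite, and an F-invariant subspace W of ℝ^d, such that: η is nondegenerate on W and W contains a timelike vector; dim W = 4 if d is even and dim W = 3 if d is odd; the subspaces W, Π₁, …, Π_p are mutually η-orthogonal (η(x,y) = 0 whenever x and y belong to two distinct subspaces of the list); and ℝ^d is the internal direct sum of W, Π₁, …, Π_p. -/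
open scoped BigOperators

section LorentzianForms

open Module Submodule

variable {V : Type*} [AddCommGroup V] [Module ℝ V]

/-- An `F`-invariant plane on which `B` is positive definite. -/
structure IsSpacelikePlane (B : LinearMap.BilinForm ℝ V) (F : V →ₗ[ℝ] V)
    (P : Submodule ℝ V) : Prop where
  finrank_eq : finrank ℝ P = 2
  map_mem : ∀ x ∈ P, F x ∈ P
  pos : ∀ x ∈ P, x ≠ 0 → 0 < B x x

/-- `B` is positive definite on the orthogonal complement of every timelike vector. -/
def TimelikeOrthogonalPos (B : LinearMap.BilinForm ℝ V) : Prop :=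
  ∀ t x, B t t < 0 → B t x = 0 → x ≠ 0 → 0 < B x x

theorem finrank_span_pair_le_two (x y : V) : finrank ℝ (span ℝ {x, y}) ≤ 2 := by
  classical
  have h := finrank_span_finset_le_card (R := ℝ) ({x, y} : Finset V)
  rw [Finset.coe_insert, Finset.coe_singleton] at h
  exact h.trans Finset.card_le_two

theorem pos_of_mem_sup {B : LinearMap.BilinForm ℝ V} (hB : ∀ x y, B x y = B y x)
    {P Q : Submodule ℝ V} (hP : ∀ x ∈ P, x ≠ 0 → 0 < B x x) (hQ : ∀ x ∈ Q, x ≠ 0 → 0 < B x x)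
    (hPQ : ∀ x ∈ P, ∀ y ∈ Q, B x y = 0) : ∀ x ∈ P ⊔ Q, x ≠ 0 → 0 < B x x := by
  intro x hx hne
  obtain ⟨p, hp, q, hq, rfl⟩ := mem_sup.mp hx
  have h : B (p + q) (p + q) = B p p + B q q := by
    simp [hPQ p hp q hq, hB q p]
  rw [h]
  by_cases hp0 : p = 0
  · subst hp0
    simpa using hQ q hq (by simpa using hne)
  · by_cases hq0 : q = 0
    · subst hq0
      simpa using hP p hp hp0
    · exact add_pos (hP p hp hp0) (hQ q hq hq0)

theorem disjoint_of_nondegenerate_of_orthogonal {B : LinearMap.BilinForm ℝ V}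
    {P Q : Submodule ℝ V}
    (hP : ∀ x ∈ P, (∀ y ∈ P, B x y = 0) → x = 0)
    (hPQ : ∀ x ∈ Q, ∀ y ∈ P, B x y = 0) : Disjoint P Q :=
  disjoint_def.mpr fun x hxP hxQ => hP x hxP (hPQ x hxQ)

theorem iSupIndep_of_orthogonal {B : LinearMap.BilinForm ℝ V} {ι : Type*}
    {A : ι → Submodule ℝ V} (hB : ∀ x y, B x y = B y x)
    (hnd : ∀ i, ∀ x ∈ A i, (∀ y ∈ A i, B x y = 0) → x = 0)
    (horth : ∀ i j, i ≠ j → ∀ x ∈ A i, ∀ y ∈ A j, B x y = 0) : iSupIndep A := by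
  intro i
  refine disjoint_of_nondegenerate_of_orthogonal (B := B) (hnd i) fun x hx y hy => ?_
  have hle : ⨆ j, ⨆ _ : j ≠ i, A j ≤ B.orthogonal (A i) :=
    iSup₂_le fun j hj z hz w hw => horth i j hj.symm w hw z hz
  rw [hB]
  exact hle hx y hy

variable {B : LinearMap.BilinForm ℝ V} {F : V →ₗ[ℝ] V}

theorem bilin_self_apply_eq_zero (hB : ∀ x y, B x y = B y x)
    (hF : ∀ x y, B (F x) y = - B x (F y)) (x : V) : B x (F x) = 0 := by
  have := hF x x
  rw [hB] at this
  linarith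

theorem orthogonal_map_mem (hF : ∀ x y, B (F x) y = - B x (F y)) {U : Submodule ℝ V}
    (hU : ∀ x ∈ U, F x ∈ U) {x : V} (hx : x ∈ B.orthogonal U) : F x ∈ B.orthogonal U := by
  intro y hy
  have h1 : B (F y) x = 0 := hx _ (hU y hy)
  have h2 := hF y x
  change B y (F x) = 0
  linarith

theorem mem_span_singleton_of_null (hL : TimelikeOrthogonalPos B) (hB : ∀ x y, B x y = B y x)
    {t x y : V} (ht : B t t < 0) (hx0 : x ≠ 0)
    (hx : B x x = 0) (hy : B y y = 0) (hxy : B x y = 0) : y ∈ span ℝ {x} := by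
  have htx : B t x ≠ 0 := fun h => (hL t x ht h hx0).ne' hx
  refine mem_span_singleton.mpr ⟨B t y / B t x, ?_⟩
  by_contra h
  refine (hL t (y - (B t y / B t x) • x) ht ?_ (sub_ne_zero.mpr (Ne.symm h))).ne' ?_
  · simp [htx]
  · simp [hx, hy, hxy, hB y x]

theorem isSpacelikePlane_span_pair (hB : ∀ x y, B x y = B y x)
    (hF : ∀ x y, B (F x) y = - B x (F y)) {v : V} (hv : 0 < B v v) {k : ℝ} (hk : 0 < k)
    (hFF : F (F v) = -(k • v)) : IsSpacelikePlane B F (span ℝ {v, F v}) := by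
  have h0 := bilin_self_apply_eq_zero hB hF v
  have h0' : B (F v) v = 0 := by rw [hB, h0]
  have h1 : B (F v) (F v) = k * B v v := by rw [hF, hFF]; simp
  have hsq : ∀ a b : ℝ, B (a • v + b • F v) (a • v + b • F v) = (a ^ 2 + k * b ^ 2) * B v v := by
    intro a b
    simp [h0, h0', h1]
    ring
  have hzero : ∀ a b : ℝ, (a ^ 2 + k * b ^ 2) * B v v ≤ 0 → a = 0 ∧ b = 0 := by
    intro a b h
    have h2 : a ^ 2 + k * b ^ 2 ≤ 0 := nonpos_of_mul_nonpos_left h hv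
    have ha : a ^ 2 ≤ 0 := by nlinarith [sq_nonneg b]
    have hb : b ^ 2 ≤ 0 := by nlinarith [sq_nonneg a]
    exact ⟨by nlinarith, by nlinarith⟩
  refine ⟨?_, ?_, ?_⟩
  · have hli : LinearIndependent ℝ ![v, F v] := by
      rw [LinearIndependent.pair_iff]
      intro a b hab
      apply hzero
      rw [← hsq, hab]
      simp
    have := finrank_span_eq_card hli
    rwa [Matrix.range_cons_cons_empty, Fintype.card_fin] at this
  · intro x hx
    obtain ⟨a, b, rfl⟩ := mem_span_pair.mp hx
    refine mem_span_pair.mpr ⟨-(b * k), a, ?_⟩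
    simp only [map_add, map_smul, hFF]
    module
  · intro x hx hne
    obtain ⟨a, b, rfl⟩ := mem_span_pair.mp hx
    rw [hsq]
    by_contra! h
    obtain ⟨rfl, rfl⟩ := hzero a b h
    simp at hne

theorem exists_timelike_mem_orthogonal (hB : ∀ x y, B x y = B y x) {Q : Submodule ℝ V}
    (hQ : ∀ x ∈ Q, x ≠ 0 → 0 < B x x) (hcompl : IsCompl Q (B.orthogonal Q)) {t : V}
    (ht : B t t < 0) : ∃ s ∈ B.orthogonal Q, B s s < 0 := by
  have : t ∈ Q ⊔ B.orthogonal Q := by rw [hcompl.sup_eq_top]; trivial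
  obtain ⟨q, hq, s, hs, rfl⟩ := mem_sup.mp this
  refine ⟨s, hs, ?_⟩
  have h0 : B q s = 0 := hs q hq
  have h1 : 0 ≤ B q q := by
    by_cases h : q = 0
    · simp [h]
    · exact (hQ q hq h).le
  simp [h0, hB s q] at ht
  linarith

variable [FiniteDimensional ℝ V]

theorem exists_ne_zero_apply_apply_eq [Nontrivial V] (F : V →ₗ[ℝ] V) :
    ∃ v : V, v ≠ 0 ∧ ∃ a b : ℝ, F (F v) = a • F v + b • v := by
  have hint : IsIntegral ℝ F := Algebra.IsIntegral.isIntegral F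
  obtain ⟨q, hq, r, hr⟩ :=
    WfDvdMonoid.exists_irreducible_factor (minpoly.not_isUnit ℝ F) (minpoly.ne_zero hint)
  have hne : ∃ v : V, v ≠ 0 ∧ Polynomial.aeval F q v = 0 := by
    by_contra! h
    have hr0 : Polynomial.aeval F r = 0 := by
      ext x
      by_contra hx
      refine h _ hx ?_
      rw [← Module.End.mul_apply, ← map_mul, ← hr, minpoly.aeval]
      rfl
    have hr1 : r ≠ 0 := by
      rintro rfl
      exact minpoly.ne_zero hint (by simpa using hr)
    obtain ⟨s, hs⟩ := minpoly.dvd ℝ F hr0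
    refine hq.not_isUnit (IsUnit.of_mul_eq_one s (mul_right_cancel₀ hr1 ?_))
    rw [one_mul]
    nth_rewrite 2 [hs]
    rw [hr]
    ring
  obtain ⟨v, hv, hqv⟩ := hne
  have hd := hq.natDegree_le_two
  have hexp : q.coeff 2 • F (F v) + q.coeff 1 • F v + q.coeff 0 • v = 0 := by
    rw [← hqv, Polynomial.aeval_eq_sum_range' (n := 3) (by omega)]
    simp [Finset.sum_range_succ, pow_two]
    abel
  refine ⟨v, hv, ?_⟩
  by_cases h2 : q.coeff 2 = 0
  · by_cases h1 : q.coeff 1 = 0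
    · simp only [h1, h2, zero_smul, zero_add, smul_eq_zero, hv, or_false] at hexp
      refine absurd ?_ hq.ne_zero
      ext i
      rcases i with _ | _ | _ | i
      · simpa using hexp
      · simpa using h1
      · simpa using h2
      · exact Polynomial.coeff_eq_zero_of_natDegree_lt (by omega)
    · refine ⟨-(q.coeff 0 / q.coeff 1), 0, ?_⟩
      have hFv : F v = (-(q.coeff 0 / q.coeff 1)) • v := by
        rw [h2] at hexp
        linear_combination (norm := skip) (q.coeff 1)⁻¹ • hexp
        match_scalars <;> field_simp <;> ring
      rw [zero_smul, add_zero, ← map_smul, ← hFv]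
  · refine ⟨-(q.coeff 1 / q.coeff 2), -(q.coeff 0 / q.coeff 2), ?_⟩
    linear_combination (norm := skip) (q.coeff 2)⁻¹ • hexp
    match_scalars <;> field_simp <;> ring

theorem eq_zero_or_exists_relative_eigenvector {B C : LinearMap.BilinForm ℝ V}
    (hB : ∀ x y, B x y = B y x) (hpos : ∀ x, x ≠ 0 → 0 < B x x) (hC : ∀ x y, C x y = C y x) :
    C = 0 ∨ ∃ x : V, x ≠ 0 ∧ ∃ k : ℝ, k ≠ 0 ∧ ∀ y, C x y = k * B x y := by
  have hnd : B.Nondegenerate := by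
    constructor
    all_goals
      intro x hx
      by_contra h
      exact (hpos x h).ne' (hx x)
  let core : InnerProductSpace.Core ℝ V :=
    { inner := fun x y => B x y
      conj_inner_symm := fun x y => by simpa using hB y x
      re_inner_nonneg := fun x => by
        by_cases h : x = 0
        · simp [h]
        · simpa using (hpos x h).le
      add_left := fun x y z => by simp
      smul_left := fun x y r => by simp
      definite := fun x hx => by
        by_contra h
        exact (hpos x h).ne' hx }
  let : NormedAddCommGroup V := core.toNormedAddCommGroup
  let : InnerProductSpace ℝ V := InnerProductSpace.ofCore core.toCore
  have hin : ∀ x y : V, inner ℝ x y = B x y := fun x y => rfl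
  let R := C.symmCompOfNondegenerate B hnd
  have hR : ∀ x y, B (R x) y = C x y := fun x y => C.symmCompOfNondegenerate_left_apply hnd y x
  have hsymm : R.IsSymmetric := fun x y => by
    rw [hin, hin, hR, hB, hR, hC]
  by_cases h0 : ∀ i, R (hsymm.eigenvectorBasis rfl i) = 0
  · left
    have hR0 : R = 0 := (hsymm.eigenvectorBasis rfl).toBasis.ext fun i => by simpa using h0 i
    ext x y
    rw [← hR, hR0]
    simp
  · right
    push Not at h0
    obtain ⟨i, hi⟩ := h0
    have hev := hsymm.hasEigenvector_eigenvectorBasis rfl i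
    refine ⟨_, hev.2, hsymm.eigenvalues rfl i, ?_, fun y => ?_⟩
    · intro h
      have := hev.apply_eq_smul
      rw [h] at this
      exact hi (by simpa using this)
    · rw [← hR, hev.apply_eq_smul]
      simp

theorem exists_le_finrank_eq_two {K : Submodule ℝ V} (hK : 2 ≤ finrank ℝ K) :
    ∃ P ≤ K, finrank ℝ P = 2 := by
  have : Nontrivial K := Module.finrank_pos_iff.mp (by omega : 0 < finrank ℝ K)
  obtain ⟨x, hx⟩ := exists_ne (0 : K)
  obtain ⟨y, hxy⟩ := exists_linearIndependent_pair_of_one_lt_finrank (by omega : 1 < finrank ℝ K) hx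
  refine ⟨(span ℝ (Set.range ![x, y])).map K.subtype, map_subtype_le _ _, ?_⟩
  rw [finrank_map_subtype_eq, finrank_span_eq_card hxy]
  simp

theorem finrank_le_finrank_add_orthogonal (hB : ∀ x y, B x y = B y x) (U : Submodule ℝ V) :
    finrank ℝ V ≤ finrank ℝ U + finrank ℝ (B.orthogonal U) := by
  rw [LinearMap.BilinForm.finrank_add_finrank_orthogonal
    (fun x y h => by rwa [hB] at h) U]
  omega

theorem exists_isSpacelikePlane_of_le_ker {K : Submodule ℝ V} (hK : 2 ≤ finrank ℝ K)
    (hker : ∀ x ∈ K, F x = 0) (hpos : ∀ x ∈ K, x ≠ 0 → 0 < B x x) :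
    ∃ P, IsSpacelikePlane B F P := by
  obtain ⟨P, hPK, hP⟩ := exists_le_finrank_eq_two hK
  refine ⟨P, hP, fun x hx => ?_, fun x hx => hpos x (hPK hx)⟩
  rw [hker x (hPK hx)]
  exact P.zero_mem

theorem exists_isSpacelikePlane_of_semidefinite (hB : ∀ x y, B x y = B y x)
    (hF : ∀ x y, B (F x) y = - B x (F y)) {N : Submodule ℝ V} {n : V} (hnN : n ∈ N)
    (hN : ∀ x ∈ N, F x ∈ N) (hn : F n = 0) (hnn : ∀ x ∈ N, B n x = 0)
    (hnonneg : ∀ x ∈ N, 0 ≤ B x x) (hnull : ∀ x ∈ N, B x x = 0 → x ∈ span ℝ {n})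
    (hrank : finrank ℝ (span ℝ {n}) + 3 ≤ finrank ℝ N) :
    ∃ P, IsSpacelikePlane B F P := by
  obtain ⟨C, hC⟩ := (span ℝ {n}).exists_isCompl
  have hdimC := finrank_add_eq_of_isCompl hC
  have hposS : ∀ x ∈ N ⊓ C, x ≠ 0 → 0 < B x x := by
    intro x hx hne
    refine lt_of_le_of_ne (hnonneg x hx.1) fun h => hne ?_
    exact disjoint_def.mp hC.disjoint x (hnull x hx.1 h.symm) hx.2
  have hdimS : 3 ≤ finrank ℝ (N ⊓ C : Submodule ℝ V) := by
    have h1 := finrank_sup_add_finrank_inf_eq N C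
    have h2 := finrank_le (N ⊔ C)
    omega
  set S := N ⊓ C
  let G : S →ₗ[ℝ] V := F ∘ₗ S.subtype
  rcases eq_zero_or_exists_relative_eigenvector (B := B.restrict S) (C := B.compl₁₂ G G)
    (fun x y => hB x y) (fun x hx => hposS x x.2 (by simpa using hx)) (fun x y => hB _ _) with
    h0 | ⟨x, hx, k, hk, hxy⟩
  · have hGn : ∀ x ∈ S, F x ∈ span ℝ {n} := fun x hx =>
      hnull _ (hN x hx.1) (by simpa [G] using LinearMap.congr_fun₂ h0 ⟨x, hx⟩ ⟨x, hx⟩)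
    refine exists_isSpacelikePlane_of_le_ker (K := (LinearMap.ker G).map S.subtype) ?_ ?_ ?_
    · rw [finrank_map_subtype_eq]
      have h1 := G.finrank_range_add_finrank_ker
      have h2 : LinearMap.range G ≤ span ℝ {n} := by
        rintro _ ⟨x, rfl⟩
        exact hGn x x.2
      have h3 := (finrank_mono h2).trans (finrank_span_le_card {n})
      simp at h3
      omega
    · rintro _ ⟨x, hx, rfl⟩
      exact hx
    · rintro _ ⟨x, hx, rfl⟩
      exact hposS x x.2
  · have hxpos : 0 < B x x := hposS x x.2 (by simpa using hx)
    have hkpos : 0 < k := by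
      have h1 : B (F x) (F x) = k * B x x := hxy x
      have h2 := hnonneg _ (hN x x.2.1)
      rw [h1] at h2
      exact lt_of_le_of_ne (nonneg_of_mul_nonneg_left h2 hxpos) hk.symm
    set z := F (F x) + k • (x : V) with hz
    have hzN : z ∈ N := N.add_mem (hN _ (hN _ x.2.1)) (N.smul_mem _ x.2.1)
    have hzS : ∀ y ∈ S, B z y = 0 := by
      intro y hy
      have h1 : B (F x) (F y) = k * B x y := hxy ⟨y, hy⟩
      simp [hz, hF (F x) y, h1]
    have hzz : B z z = 0 := by
      have : z ∈ span ℝ {n} ⊔ C := by rw [hC.sup_eq_top]; trivial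
      obtain ⟨m, hm, c, hc, hmc⟩ := mem_sup.mp this
      obtain ⟨a, rfl⟩ := mem_span_singleton.mp hm
      have hcN : c ∈ N := by
        rw [← eq_sub_iff_add_eq'] at hmc
        rw [hmc]
        exact N.sub_mem hzN (N.smul_mem _ hnN)
      nth_rewrite 2 [← hmc]
      rw [map_add, map_smul, hB z n, hnn z hzN, hzS c ⟨hcN, hc⟩]
      simp
    obtain ⟨a, ha⟩ := mem_span_singleton.mp (hnull z hzN hzz)
    refine ⟨_, isSpacelikePlane_span_pair hB hF (v := (x : V) - (a / k) • n) ?_ hkpos ?_⟩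
    · have h1 : B x n = 0 := by rw [hB]; exact hnn x x.2.1
      simpa [h1, hnn x x.2.1, hnn n hnN] using hxpos
    · have h1 : F (F x) = a • n - k • (x : V) := by rw [ha, hz]; abel
      simp only [map_sub, map_smul, hn, smul_zero, sub_zero, h1]
      match_scalars <;> field_simp

theorem exists_isSpacelikePlane_of_timelike (hL : TimelikeOrthogonalPos B)
    (hB : ∀ x y, B x y = B y x) (hF : ∀ x y, B (F x) y = - B x (F y)) (hdim : 5 ≤ finrank ℝ V)
    {U : Submodule ℝ V} (hU : ∀ x ∈ U, F x ∈ U) (hrank : finrank ℝ U ≤ 2)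
    {t : V} (htU : t ∈ U) (ht : B t t < 0) : ∃ P, IsSpacelikePlane B F P := by
  have hpos : ∀ x ∈ B.orthogonal U, x ≠ 0 → 0 < B x x := fun x hx => hL t x ht (hx t htU)
  refine exists_isSpacelikePlane_of_semidefinite hB hF (N := B.orthogonal U) (n := 0)
    (zero_mem _) (fun x => orthogonal_map_mem hF hU) (map_zero F) (by simp) ?_ ?_ ?_
  · intro x hx
    by_cases h : x = 0
    · simp [h]
    · exact (hpos x hx h).le
  · intro x hx h
    by_contra hne
    exact (hpos x hx (by simpa using hne)).ne' h
  · have := finrank_le_finrank_add_orthogonal hB U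
    rw [span_zero_singleton, finrank_bot]
    omega

theorem exists_isSpacelikePlane_of_null_of_apply_eq_zero (hL : TimelikeOrthogonalPos B)
    (hB : ∀ x y, B x y = B y x) (hF : ∀ x y, B (F x) y = - B x (F y)) (hdim : 5 ≤ finrank ℝ V)
    {t n : V} (ht : B t t < 0) (hn0 : n ≠ 0) (hn : B n n = 0) (hFn : F n = 0) :
    ∃ P, IsSpacelikePlane B F P := by
  have hmem : ∀ x ∈ B.orthogonal (span ℝ {n}), B n x = 0 :=
    fun x hx => hx n (mem_span_singleton_self n)
  refine exists_isSpacelikePlane_of_semidefinite hB hF (N := B.orthogonal (span ℝ {n})) (n := n)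
    ?_ (fun x => orthogonal_map_mem hF ?_) hFn hmem ?_ ?_ ?_
  · intro y hy
    obtain ⟨a, rfl⟩ := mem_span_singleton.mp hy
    simp [hn]
  · intro y hy
    obtain ⟨a, rfl⟩ := mem_span_singleton.mp hy
    simp [hFn]
  · intro x hx
    by_contra! h
    exact (hL x n h (by rw [hB, hmem x hx]) hn0).ne' hn
  · exact fun x hx h => mem_span_singleton_of_null hL hB ht hn0 hn h (hmem x hx)
  · have := finrank_le_finrank_add_orthogonal hB (span ℝ {n})
    rw [finrank_span_singleton hn0] at this ⊢
    omega

theorem exists_isSpacelikePlane_of_null_of_apply_eq_smul (hL : TimelikeOrthogonalPos B)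
    (hB : ∀ x y, B x y = B y x) (hF : ∀ x y, B (F x) y = - B x (F y)) (hdim : 5 ≤ finrank ℝ V)
    {t n : V} (ht : B t t < 0) (hn0 : n ≠ 0) (hn : B n n = 0) {c : ℝ} (hFn : F n = c • n) :
    ∃ P, IsSpacelikePlane B F P := by
  by_cases hc : c = 0
  · exact exists_isSpacelikePlane_of_null_of_apply_eq_zero hL hB hF hdim ht hn0 hn
      (by simp [hFn, hc])
  have hsurj : ¬ Function.Surjective (F + c • LinearMap.id : V →ₗ[ℝ] V) := by
    intro hs
    obtain ⟨x, hx⟩ := hs t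
    refine (hL t n ht ?_ hn0).ne' hn
    rw [← hx]
    simp [hF x n, hFn]
  rw [← LinearMap.injective_iff_surjective, ← LinearMap.ker_eq_bot, Submodule.eq_bot_iff] at hsurj
  push Not at hsurj
  obtain ⟨m, hm, hm0⟩ := hsurj
  have hFm : F m = -(c • m) := by
    rw [← add_eq_zero_iff_eq_neg]
    simpa using hm
  have hmm : B m m = 0 := by
    have := bilin_self_apply_eq_zero hB hF m
    simpa [hFm, hc] using this
  have hnm : B n m ≠ 0 := by
    intro h
    obtain ⟨a, rfl⟩ := mem_span_singleton.mp (mem_span_singleton_of_null hL hB ht hn0 hn hmm h)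
    rw [map_smul, hFn, ← sub_eq_zero, sub_neg_eq_add, ← smul_assoc, ← smul_assoc, ← add_smul] at hFm
    have h1 : a ≠ 0 := by rintro rfl; simp at hm0
    rcases smul_eq_zero.mp hFm with h2 | h2
    · have : 2 * (a * c) = 0 := by simpa [two_mul, mul_comm] using h2
      simp [h1, hc] at this
    · exact hn0 h2
  refine exists_isSpacelikePlane_of_timelike hL hB hF hdim (U := span ℝ {n, m})
    (t := n - (B n m) • m) ?_ (finrank_span_pair_le_two n m) ?_ ?_
  · intro x hx
    obtain ⟨a, b, rfl⟩ := mem_span_pair.mp hx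
    refine mem_span_pair.mpr ⟨a * c, -(b * c), ?_⟩
    simp only [map_add, map_smul, hFn, hFm]
    module
  · exact mem_span_pair.mpr ⟨1, -(B n m), by module⟩
  · have := mul_self_pos.mpr hnm
    have h : B (n - B n m • m) (n - B n m • m) = -2 * (B n m * B n m) := by
      simp only [map_sub, LinearMap.sub_apply, map_smul, LinearMap.smul_apply, smul_eq_mul, hn,
        hmm, hB m n]
      ring
    rw [h]
    linarith

theorem exists_pos_apply_eq_zero_or_isSpacelikePlane (hL : TimelikeOrthogonalPos B)
    (hB : ∀ x y, B x y = B y x) (hF : ∀ x y, B (F x) y = - B x (F y)) (hdim : 5 ≤ finrank ℝ V)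
    {U : Submodule ℝ V} (hU : ∀ x ∈ U, F x ∈ U) {t : V} (htU : t ∈ U) (ht : B t t < 0) :
    (∃ v ∈ U, 0 < B v v ∧ F v = 0) ∨ ∃ P, IsSpacelikePlane B F P := by
  have ht0 : t ≠ 0 := by rintro rfl; simp at ht
  have : Nontrivial U := ⟨⟨t, htU⟩, 0, by simpa using ht0⟩
  obtain ⟨v', hv', a, b, hFF'⟩ := exists_ne_zero_apply_apply_eq (F.restrict hU)
  obtain ⟨v, hvU, hv0, hFF⟩ : ∃ v ∈ U, v ≠ 0 ∧ F (F v) = a • F v + b • v :=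
    ⟨v', v'.2, by simpa using hv', by simpa using congrArg Subtype.val hFF'⟩
  have h0 := bilin_self_apply_eq_zero hB hF v
  have h1 : B (F v) (F v) = -(b * B v v) := by rw [hF, hFF]; simp [h0]
  have h2 : a * B (F v) (F v) = 0 := by
    have := bilin_self_apply_eq_zero hB hF (F v)
    simpa [hFF, hB (F v) v, h0] using this
  have hinv : ∀ x ∈ span ℝ {v, F v}, F x ∈ span ℝ {v, F v} := by
    intro x hx
    obtain ⟨c, d, rfl⟩ := mem_span_pair.mp hx
    refine mem_span_pair.mpr ⟨d * b, c + d * a, ?_⟩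
    simp only [map_add, map_smul, hFF]
    module
  have htime : ∀ s ∈ span ℝ {v, F v}, B s s < 0 → ∃ P, IsSpacelikePlane B F P := fun s hs hss =>
    exists_isSpacelikePlane_of_timelike hL hB hF hdim hinv (finrank_span_pair_le_two _ _) hs hss
  rcases lt_trichotomy (B v v) 0 with hv | hv | hv
  · exact .inr (htime v (subset_span (by simp)) hv)
  · obtain ⟨c, hc⟩ := mem_span_singleton.mp
      (mem_span_singleton_of_null hL hB ht hv0 hv (by simp [h1, hv]) h0)
    exact .inr (exists_isSpacelikePlane_of_null_of_apply_eq_smul hL hB hF hdim ht hv0 hv hc.symm)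
  · by_cases hFv : F v = 0
    · exact .inl ⟨v, hvU, hv, hFv⟩
    right
    rcases lt_trichotomy b 0 with hb | hb | hb
    · have ha : a = 0 := by
        rcases mul_eq_zero.mp h2 with h | h
        · exact h
        · nlinarith
      refine ⟨_, isSpacelikePlane_span_pair hB hF hv (neg_pos.mpr hb) ?_⟩
      simp [hFF, ha]
    · refine exists_isSpacelikePlane_of_null_of_apply_eq_smul hL hB hF hdim ht hFv
        (by simp [h1, hb]) (c := a) ?_
      simp [hFF, hb]
    · refine htime (F v) (subset_span (by simp)) ?_
      rw [h1]
      have := mul_pos hb hv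
      linarith

theorem isCompl_orthogonal_of_pos (hB : ∀ x y, B x y = B y x) {Q : Submodule ℝ V}
    (hQ : ∀ x ∈ Q, x ≠ 0 → 0 < B x x) : IsCompl Q (B.orthogonal Q) := by
  rw [LinearMap.BilinForm.isCompl_orthogonal_iff_disjoint (fun x y h => by rwa [hB] at h)]
  refine disjoint_def.mpr fun x hx hx' => ?_
  by_contra h
  exact (hQ x hx h).ne' (hx' x hx)

theorem exists_isSpacelikePlane (hL : TimelikeOrthogonalPos B)
    (hB : ∀ x y, B x y = B y x) (hF : ∀ x y, B (F x) y = - B x (F y)) (hdim : 5 ≤ finrank ℝ V)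
    {t : V} (ht : B t t < 0) : ∃ P, IsSpacelikePlane B F P := by
  rcases exists_pos_apply_eq_zero_or_isSpacelikePlane hL hB hF hdim (U := ⊤) (by simp)
    (mem_top (x := t)) ht with ⟨v, -, hv, hFv⟩ | h
  swap
  · exact h
  have hspan : ∀ u : V, 0 < B u u → ∀ x ∈ span ℝ {u}, x ≠ 0 → 0 < B x x := by
    intro u hu x hx hne
    obtain ⟨a, rfl⟩ := mem_span_singleton.mp hx
    have ha : a ≠ 0 := by rintro rfl; simp at hne
    have := mul_pos (mul_self_pos.mpr ha) hu
    simpa [mul_assoc] using this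
  have hker : ∀ u : V, F u = 0 → ∀ x ∈ span ℝ {u}, F x = 0 := by
    intro u hu x hx
    obtain ⟨a, rfl⟩ := mem_span_singleton.mp hx
    simp [hu]
  have hne : ∀ u : V, 0 < B u u → u ≠ 0 := by
    rintro u hu rfl
    simp at hu
  obtain ⟨s, hs, hss⟩ := exists_timelike_mem_orthogonal hB (hspan v hv)
    (isCompl_orthogonal_of_pos hB (hspan v hv)) ht
  rcases exists_pos_apply_eq_zero_or_isSpacelikePlane hL hB hF hdim
    (fun x => orthogonal_map_mem hF
      (fun y hy => by rw [hker v hFv y hy]; exact zero_mem _)) hs hss with ⟨w, hw, hww, hFw⟩ | h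
  swap
  · exact h
  have horth : ∀ x ∈ span ℝ {v}, ∀ y ∈ span ℝ {w}, B x y = 0 := by
    intro x hx y hy
    obtain ⟨a, rfl⟩ := mem_span_singleton.mp hy
    have : B x w = 0 := hw x hx
    simp [this]
  refine exists_isSpacelikePlane_of_le_ker (K := span ℝ {v} ⊔ span ℝ {w}) ?_ ?_
    (pos_of_mem_sup hB (hspan v hv) (hspan w hww) horth)
  · have hdisj : Disjoint (span ℝ {v}) (span ℝ {w}) := by
      refine disjoint_def.mpr fun x hx hx' => ?_
      by_contra h
      exact (hspan v hv x hx h).ne' (horth x hx x hx')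
    have h := finrank_sup_add_finrank_inf_eq (span ℝ {v}) (span ℝ {w})
    rw [hdisj.eq_bot, finrank_bot, finrank_span_singleton (hne v hv),
      finrank_span_singleton (hne w hww)] at h
    omega
  · intro x hx
    obtain ⟨p, hp, q, hq, rfl⟩ := mem_sup.mp hx
    rw [map_add, hker v hFv p hp, hker w hFw q hq, add_zero]

theorem exists_isSpacelikePlane_le (hL : TimelikeOrthogonalPos B)
    (hB : ∀ x y, B x y = B y x) (hF : ∀ x y, B (F x) y = - B x (F y)) {W : Submodule ℝ V}
    (hW : ∀ x ∈ W, F x ∈ W) (hdim : 5 ≤ finrank ℝ W) {t : V} (htW : t ∈ W) (ht : B t t < 0) :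
    ∃ P ≤ W, IsSpacelikePlane B F P := by
  obtain ⟨P, hP⟩ := exists_isSpacelikePlane (B := B.restrict W) (F := F.restrict hW)
    (fun s x hs hx hne => hL s x hs hx (by simpa using hne)) (fun x y => hB x y)
    (fun x y => hF x y) hdim (t := ⟨t, htW⟩) ht
  refine ⟨P.map W.subtype, map_subtype_le _ _, ?_, ?_, ?_⟩
  · rw [finrank_map_subtype_eq, hP.finrank_eq]
  · rintro _ ⟨x, hx, rfl⟩
    exact ⟨_, hP.map_mem x hx, rfl⟩
  · rintro _ ⟨x, hx, rfl⟩ hne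
    exact hP.pos x hx (by rintro rfl; simp at hne)

theorem exists_orthogonal_family_isSpacelikePlane (hL : TimelikeOrthogonalPos B)
    (hB : ∀ x y, B x y = B y x) (hF : ∀ x y, B (F x) y = - B x (F y)) {t : V} (ht : B t t < 0)
    (k : ℕ) (hk : 2 * k + 3 ≤ finrank ℝ V) :
    ∃ P : Fin k → Submodule ℝ V, (∀ i, IsSpacelikePlane B F (P i)) ∧
      (∀ i j, i ≠ j → ∀ x ∈ P i, ∀ y ∈ P j, B x y = 0) ∧
      (∀ x ∈ ⨆ i, P i, x ≠ 0 → 0 < B x x) ∧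
      (∀ x ∈ ⨆ i, P i, F x ∈ ⨆ i, P i) ∧
      finrank ℝ (⨆ i, P i : Submodule ℝ V) = 2 * k := by
  induction k with
  | zero => refine ⟨Fin.elim0, fun i => i.elim0, fun i => i.elim0, ?_, ?_, ?_⟩ <;> simp [iSup_of_empty]
  | succ k ih =>
    obtain ⟨P, hP, horth, hpos, hinv, hrank⟩ := ih (by omega)
    have hcompl := isCompl_orthogonal_of_pos hB hpos
    obtain ⟨s, hs, hss⟩ := exists_timelike_mem_orthogonal hB hpos hcompl ht
    have hdim := finrank_add_eq_of_isCompl hcompl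
    obtain ⟨R, hRW, hR⟩ := exists_isSpacelikePlane_le hL hB hF
      (fun x => orthogonal_map_mem hF hinv) (by omega) hs hss
    have hPR : ∀ x ∈ ⨆ i, P i, ∀ y ∈ R, B x y = 0 := fun x hx y hy => hRW hy x hx
    have hPR' : ∀ i, ∀ x ∈ P i, ∀ y ∈ R, B x y = 0 := fun i x hx =>
      hPR x (mem_iSup_of_mem i hx)
    have hsup : ⨆ i, Fin.snoc (α := fun _ => Submodule ℝ V) P R i = (⨆ i, P i) ⊔ R := by
      apply le_antisymm
      · refine iSup_le fun i => ?_
        refine Fin.lastCases ?_ (fun j => ?_) i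
        · simp
        · simpa using le_sup_of_le_left (le_iSup P j)
      · refine sup_le (iSup_le fun j => ?_) ?_
        · refine le_iSup_of_le j.castSucc ?_
          simp
        · refine le_iSup_of_le (Fin.last k) ?_
          simp
    refine ⟨Fin.snoc (α := fun _ => Submodule ℝ V) P R, ?_, ?_, ?_, ?_, ?_⟩
    · intro i
      refine Fin.lastCases ?_ (fun j => ?_) i
      · simpa using hR
      · simpa using hP j
    · intro i j
      refine Fin.lastCases ?_ (fun i => ?_) i <;> refine Fin.lastCases ?_ (fun j => ?_) j
      · simp
      · simp only [Fin.snoc_last, Fin.snoc_castSucc]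
        intro _ x hx y hy
        rw [hB]
        exact hPR' j y hy x hx
      · simp only [Fin.snoc_last, Fin.snoc_castSucc]
        exact fun _ => hPR' i
      · simp only [Fin.snoc_castSucc]
        exact fun h => horth i j (by rintro rfl; exact h rfl)
    · rw [hsup]
      exact pos_of_mem_sup hB hpos hR.pos hPR
    · rw [hsup]
      intro x hx
      obtain ⟨p, hp, q, hq, rfl⟩ := mem_sup.mp hx
      rw [map_add]
      exact add_mem (mem_sup_left (hinv p hp)) (mem_sup_right (hR.map_mem q hq))
    · have h := finrank_sup_add_finrank_inf_eq (⨆ i, P i) R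
      rw [(hcompl.disjoint.mono_right hRW).eq_bot, finrank_bot, hrank, hR.finrank_eq] at h
      rw [hsup]
      omega

end LorentzianForms

/-- The Minkowski form as a bilinear form. -/
noncomputable def minkBilin (d : ℕ) : LinearMap.BilinForm ℝ (Fin d → ℝ) :=
  LinearMap.mk₂ ℝ (mink d)
    (fun x y z => by simp [mink, mul_add, add_mul, Finset.sum_add_distrib])
    (fun c x y => by
      simp only [mink, Pi.smul_apply, smul_eq_mul, Finset.mul_sum]
      exact Finset.sum_congr rfl fun i _ => by ring)
    (fun x y z => by simp [mink, mul_add, Finset.sum_add_distrib])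
    (fun c x y => by
      simp only [mink, Pi.smul_apply, smul_eq_mul, Finset.mul_sum]
      exact Finset.sum_congr rfl fun i _ => by ring)

theorem minkBilin_apply (d : ℕ) (x y : Fin d → ℝ) : minkBilin d x y = mink d x y := rfl

theorem mink_succ (n : ℕ) (x y : Fin (n + 1) → ℝ) :
    mink (n + 1) x y = -(x 0 * y 0) + ∑ i : Fin n, x i.succ * y i.succ := by
  simp [mink, Fin.sum_univ_succ]

theorem exists_mink_self_neg {d : ℕ} (hd : 0 < d) : ∃ t, mink d t t < 0 := by
  obtain ⟨n, rfl⟩ := Nat.exists_eq_succ_of_ne_zero hd.ne'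
  exact ⟨Pi.single 0 1, by simp [mink_succ]⟩

theorem timelikeOrthogonalPos_minkBilin {d : ℕ} (hd : 0 < d) :
    TimelikeOrthogonalPos (minkBilin d) := by
  obtain ⟨n, rfl⟩ := Nat.exists_eq_succ_of_ne_zero hd.ne'
  intro t x ht htx hx
  rw [minkBilin_apply, mink_succ] at *
  have hcs := Finset.sum_mul_sq_le_sq_mul_sq Finset.univ (fun i : Fin n => t i.succ)
    (fun i => x i.succ)
  simp only [← pow_two] at *
  set T := ∑ i : Fin n, t i.succ ^ 2
  set X := ∑ i : Fin n, x i.succ ^ 2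
  have hX0 : 0 ≤ X := by positivity
  have hprod : ∑ i : Fin n, t i.succ * x i.succ = t 0 * x 0 := by linarith
  rw [hprod, mul_pow] at hcs
  have ht0 : 0 < t 0 ^ 2 := by
    have : 0 ≤ T := by positivity
    linarith
  have hXpos : 0 < X := by
    refine lt_of_le_of_ne hX0 fun h => hx ?_
    rw [← h, mul_zero] at hcs
    have hx0 : x 0 = 0 := by
      by_contra h0
      have := mul_pos ht0 (pow_pos (abs_pos.mpr h0) 2)
      rw [sq_abs] at this
      linarith
    have hxs := (Finset.sum_eq_zero_iff_of_nonneg fun i _ => sq_nonneg (x (Fin.succ i))).mp h.symm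
    ext i
    refine Fin.cases hx0 (fun j => ?_) i
    simpa using hxs j (Finset.mem_univ j)
  have h1 : T * X < t 0 ^ 2 * X := mul_lt_mul_of_pos_right (by linarith) hXpos
  have h2 : x 0 ^ 2 < X := lt_of_mul_lt_mul_left (hcs.trans_lt h1) ht0.le
  linarith

/-- Block decomposition of Minkowski space into `p = ⌊(d-1)/2⌋ - 1` spacelike
`F`-invariant planes and an `F`-invariant Lorentzian subspace `W` of dimension
4 (`d` even) or 3 (`d` odd), all mutually orthogonal and summing directly
to `ℝ^d`. -/
theorem stmt8 (d : ℕ) (hd : 3 ≤ d)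
    (F : (Fin d → ℝ) →ₗ[ℝ] (Fin d → ℝ)) (hF : IsSkew d F) :
    ∃ (W : Submodule ℝ (Fin d → ℝ))
      (P : Fin ((d - 1) / 2 - 1) → Submodule ℝ (Fin d → ℝ)),
      (∀ i, Module.finrank ℝ (P i) = 2) ∧
      (∀ i, ∀ x ∈ P i, F x ∈ P i) ∧
      (∀ i, ∀ x ∈ P i, x ≠ 0 → 0 < mink d x x) ∧
      (∀ x ∈ W, F x ∈ W) ∧
      (∀ x ∈ W, (∀ y ∈ W, mink d x y = 0) → x = 0) ∧
      (∃ x ∈ W, mink d x x < 0) ∧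
      Module.finrank ℝ W = (if d % 2 = 0 then 4 else 3) ∧
      (∀ i j, i ≠ j → ∀ x ∈ P i, ∀ y ∈ P j, mink d x y = 0) ∧
      (∀ i, ∀ x ∈ W, ∀ y ∈ P i, mink d x y = 0) ∧
      DirectSum.IsInternal
        (fun o : Option (Fin ((d - 1) / 2 - 1)) => o.elim W fun i => P i) := by
  have hd0 : 0 < d := by omega
  have hL := timelikeOrthogonalPos_minkBilin hd0
  have hB : ∀ x y, minkBilin d x y = minkBilin d y x := mink_comm d
  obtain ⟨t, ht⟩ := exists_mink_self_neg hd0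
  obtain ⟨P, hP, horth, hpos, hinv, hrank⟩ :=
    exists_orthogonal_family_isSpacelikePlane (B := minkBilin d) hL hB hF ht ((d - 1) / 2 - 1)
      (by rw [Module.finrank_fin_fun]; omega)
  have hcompl := isCompl_orthogonal_of_pos hB hpos
  obtain ⟨s, hs, hss⟩ := exists_timelike_mem_orthogonal hB hpos hcompl ht
  have hdim := Submodule.finrank_add_eq_of_isCompl hcompl
  rw [hrank, Module.finrank_fin_fun] at hdim
  set W := (minkBilin d).orthogonal (⨆ i, P i)
  have hWnd : ∀ x ∈ W, (∀ y ∈ W, minkBilin d x y = 0) → x = 0 := by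
    intro x hx h
    by_contra hne
    exact (hL s x hss (by rw [hB, h s hs]) hne).ne' (h x hx)
  have hPW : ∀ i, ∀ x ∈ P i, ∀ y ∈ W, minkBilin d x y = 0 := fun i x hx y hy =>
    hy x (Submodule.mem_iSup_of_mem i hx)
  have hWP : ∀ i, ∀ x ∈ W, ∀ y ∈ P i, minkBilin d x y = 0 := fun i x hx y hy => by
    rw [hB, hPW i y hy x hx]
  refine ⟨W, P, fun i => (hP i).finrank_eq, fun i => (hP i).map_mem, fun i => (hP i).pos,
    fun x => orthogonal_map_mem (B := minkBilin d) hF hinv, hWnd, ⟨s, hs, hss⟩, ?_, horth, hWP, ?_⟩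
  · split_ifs <;> omega
  · rw [DirectSum.isInternal_submodule_iff_iSupIndep_and_iSup_eq_top]
    constructor
    · refine iSupIndep_of_orthogonal hB ?_ ?_
      · rintro (_ | i)
        · exact hWnd
        · intro x hx h
          by_contra hne
          exact ((hP i).pos x hx hne).ne' (h x hx)
      · rintro (_ | i) (_ | j) hij
        · exact absurd rfl hij
        · exact hWP j
        · exact hPW i
        · exact horth i j (by rintro rfl; exact hij rfl)
    · rw [iSup_option]
      exact hcompl.symm.sup_eq_top
end

section
/- Let F be a skew-symmetric endomorphism of Minkowski space 𝕄^{1,d-1} and let P ∈ ℂ[X] be the characteristic polynomial of F∘F (the characteristic polynomial of the matrix of F², with real coefficients mapped into ℂ). Then: (1) for every nonzero complex number z, the multiplicity of z as a root of P is even; and (2) the multiplicity of 0 as a root of P has the same parity as d. -/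
open scoped BigOperators

namespace Polynomial

theorem rootMultiplicity_expand_two {K : Type*} [Field K] [NeZero (2 : K)] {Q : K[X]}
    (hQ : Q ≠ 0) {a : K} (ha : a ≠ 0) :
    (expand K 2 Q).rootMultiplicity a = Q.rootMultiplicity (a ^ 2) := by
  obtain ⟨R, hR, hnd⟩ := exists_eq_pow_rootMultiplicity_mul_and_not_dvd Q hQ (a ^ 2)
  set m := Q.rootMultiplicity (a ^ 2)
  have hRa : R.eval (a ^ 2) ≠ 0 := fun h => hnd (dvd_iff_isRoot.mpr h)
  have hS : ((X + C a) ^ m * expand K 2 R).eval a ≠ 0 := by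
    have : a + a ≠ 0 := by
      rw [← two_mul]
      exact mul_ne_zero two_ne_zero ha
    simp [expand_eval, this, hRa]
  have hfac : expand K 2 Q = (X + C a) ^ m * expand K 2 R * (X - C a) ^ m := by
    conv_lhs => rw [hR]
    simp only [map_mul, map_pow, map_sub, expand_X, expand_C]
    rw [show (X ^ 2 - C a ^ 2 : K[X]) = (X + C a) * (X - C a) by ring, mul_pow]
    ring
  have hS0 : (X + C a) ^ m * expand K 2 R ≠ 0 := fun h => hS (by simp [h])
  rw [hfac, rootMultiplicity_mul_X_sub_C_pow hS0, rootMultiplicity_eq_zero hS, zero_add]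

/-- If a polynomial over an algebraically closed field has only even nonzero root multiplicities,
then the multiplicity of the root zero has the parity of the degree. -/
theorem rootMultiplicity_zero_mod_two {K : Type*} [Field K] [IsAlgClosed K] (Q : K[X])
    (h : ∀ z ≠ 0, Even (Q.rootMultiplicity z)) :
    Q.rootMultiplicity 0 % 2 = Q.natDegree % 2 := by
  classical
  have hdeg : Q.natDegree = Q.roots.card := (IsAlgClosed.splits Q).natDegree_eq_card_roots
  have hsum : ∑ z ∈ insert 0 Q.roots.toFinset, Q.roots.count z = Q.roots.card :=
    Multiset.sum_count_eq_card fun z hz => by simp [Multiset.mem_toFinset.mpr hz]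
  have heven : Even (∑ z ∈ (insert 0 Q.roots.toFinset).erase 0, Q.roots.count z) :=
    Finset.even_sum _ fun z hz => by
      rw [count_roots]
      exact h z (Finset.ne_of_mem_erase hz)
  rw [← Finset.add_sum_erase _ _ (Finset.mem_insert_self _ _), count_roots] at hsum
  obtain ⟨k, hk⟩ := heven
  lia

end Polynomial

namespace Matrix

open Polynomial

variable {n R : Type*} [Fintype n] [DecidableEq n] [CommRing R]

theorem expand_two_charpoly_mul_self (A : Matrix n n R) :
    expand R 2 (A * A).charpoly = A.charpoly * (-A).charpoly := by
  have hneg : (-A).map C = -A.map C := by ext; simp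
  rw [charpoly, charpoly, charpoly, ← det_mul, ← AlgHom.coe_toRingHom, RingHom.map_det]
  congr 1
  have hcomm : Commute (scalar n (X : R[X])) (A.map C) :=
    scalar_commute _ (fun r => Commute.all _ _) _
  have : (scalar n (X : R[X]) - A.map C) * (scalar n X - (-A).map C)
      = scalar n (X ^ 2) - (A * A).map C := by
    rw [hneg, sub_neg_eq_add, ← hcomm.mul_self_sub_mul_self_eq', map_pow, pow_two,
      Matrix.map_mul]
  simp only [charmatrix, RingHom.mapMatrix_apply]
  rw [this]
  ext i j : 1
  by_cases hij : i = j <;> simp [hij, Matrix.map_apply, -Matrix.map_mul]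

theorem charpoly_neg_eq_of_isSkewAdjoint {J A : Matrix n n R} (hJ : IsUnit J)
    (h : J.IsSkewAdjoint A) : (-A).charpoly = A.charpoly := by
  obtain ⟨U, rfl⟩ := hJ
  have hA : Aᵀ = U.val * -A * U⁻¹.val := by
    rw [Units.eq_mul_inv_iff_mul_eq]
    exact h
  rw [← charpoly_transpose A, hA, coe_units_inv, charpoly_units_conj]

theorem even_rootMultiplicity_charpoly_mul_self {K : Type*} [Field K] [IsAlgClosed K]
    [NeZero (2 : K)] {A : Matrix n n K} (hA : (-A).charpoly = A.charpoly) {z : K} (hz : z ≠ 0) :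
    Even ((A * A).charpoly.rootMultiplicity z) := by
  obtain ⟨a, rfl⟩ := IsAlgClosed.exists_pow_nat_eq z two_pos
  have ha : a ≠ 0 := fun h => hz (by simp [h])
  have h0 := A.charpoly_monic.ne_zero
  rw [← rootMultiplicity_expand_two (charpoly_monic _).ne_zero ha, expand_two_charpoly_mul_self,
    hA, rootMultiplicity_mul (mul_ne_zero h0 h0)]
  exact ⟨_, rfl⟩

end Matrix

/-- The Gram matrix of the Minkowski form. -/
noncomputable def minkMatrix (d : ℕ) : Matrix (Fin d) (Fin d) ℝ :=
  Matrix.diagonal fun i => if (i : ℕ) = 0 then -1 else 1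

theorem mink_eq_dotProduct (d : ℕ) (x y : Fin d → ℝ) :
    mink d x y = x ⬝ᵥ (minkMatrix d).mulVec y := by
  simp only [mink, minkMatrix, dotProduct, Matrix.mulVec_diagonal]
  exact Finset.sum_congr rfl fun i _ => by ring

theorem isUnit_minkMatrix (d : ℕ) : IsUnit (minkMatrix d) := by
  rw [minkMatrix, Matrix.isUnit_diagonal, Pi.isUnit_iff]
  intro i
  split_ifs <;> simp

theorem IsSkew.isSkewAdjoint_toMatrix' {d : ℕ} {F : (Fin d → ℝ) →ₗ[ℝ] (Fin d → ℝ)}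
    (hF : IsSkew d F) : (minkMatrix d).IsSkewAdjoint (LinearMap.toMatrix' F) := by
  change (LinearMap.toMatrix' F).transpose * minkMatrix d
    = minkMatrix d * -LinearMap.toMatrix' F
  refine Matrix.ext_of_single_vecMul fun i => ?_
  refine dotProduct_eq _ _ fun y => ?_
  have h := hF (Pi.single i 1) y
  rw [mink_eq_dotProduct, mink_eq_dotProduct, ← LinearMap.toMatrix'_mulVec,
    ← LinearMap.toMatrix'_mulVec] at h
  rw [← Matrix.dotProduct_mulVec, ← Matrix.dotProduct_mulVec, ← Matrix.mulVec_mulVec,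
    ← Matrix.mulVec_mulVec, Matrix.dotProduct_mulVec, Matrix.vecMul_transpose, h,
    Matrix.neg_mulVec, Matrix.mulVec_neg, dotProduct_neg]

/-- For a skew-symmetric endomorphism `F` of `𝕄^{1,d-1}`, the nonzero complex
roots of the characteristic polynomial of `F²` have even multiplicity, and the
multiplicity of the zero root has the parity of `d`. -/
theorem stmt11 (d : ℕ)
    (F : (Fin d → ℝ) →ₗ[ℝ] (Fin d → ℝ)) (hF : IsSkew d F) :
    (∀ z : ℂ, z ≠ 0 →
      Even (((LinearMap.charpoly (F ∘ₗ F)).map (algebraMap ℝ ℂ)).rootMultiplicity z)) ∧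
    ((((LinearMap.charpoly (F ∘ₗ F)).map (algebraMap ℝ ℂ)).rootMultiplicity 0) % 2
      = d % 2) := by
  set A := LinearMap.toMatrix' F
  have hQ : (LinearMap.charpoly (F ∘ₗ F)).map (algebraMap ℝ ℂ)
      = (A.map (algebraMap ℝ ℂ) * A.map (algebraMap ℝ ℂ)).charpoly := by
    rw [← Matrix.map_mul, ← LinearMap.toMatrix'_comp, Matrix.charpoly_map]
    congr 1
    rw [← Matrix.charpoly_toLin', Matrix.toLin'_toMatrix']
  have hA : (-A.map (algebraMap ℝ ℂ)).charpoly = (A.map (algebraMap ℝ ℂ)).charpoly := by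
    have hneg : -A.map (algebraMap ℝ ℂ) = (-A).map (algebraMap ℝ ℂ) := by ext; simp
    rw [hneg, Matrix.charpoly_map, Matrix.charpoly_map,
      Matrix.charpoly_neg_eq_of_isSkewAdjoint (isUnit_minkMatrix d) hF.isSkewAdjoint_toMatrix']
  rw [hQ]
  have heven : ∀ z : ℂ, z ≠ 0 → _ := fun z hz =>
    Matrix.even_rootMultiplicity_charpoly_mul_self hA hz
  refine ⟨heven, ?_⟩
  rw [Polynomial.rootMultiplicity_zero_mod_two _ heven, Matrix.charpoly_natDegree_eq_dim,
    Fintype.card_fin]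
end

section
/- Let F be a skew-symmetric endomorphism of Minkowski space 𝕄^{1,d-1} and let P_F ∈ ℝ[X] be its characteristic polynomial. If d ≥ 4 is even, with p := d/2 - 2, there exist real numbers μ_t, μ_s and μ₁, …, μ_p such that P_F = (X² - μ_t²)·(X² + μ_s²)·∏_{i=1}^{p}(X² + μ_i²). If d ≥ 3 is odd, with p := (d-3)/2, there exist real numbers σ and μ₁, …, μ_p such that P_F = X·(X² + σ)·∏_{i=1}^{p}(X² + μ_i²). -/
open scoped BigOperators
open Polynomial

open scoped Matrix

/-! ### Even real polynomials and their roots in the right half-plane -/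

lemma comp_neg_X_of_quadratic_mul {R S : ℝ[X]} {c : ℝ} (hR : R = (X ^ 2 + C c) * S)
    (he : R.comp (-X) = R) : S.comp (-X) = S := by
  have h0 : (X ^ 2 + C c : ℝ[X]) ≠ 0 := X_pow_add_C_ne_zero two_pos c
  apply mul_left_cancel₀ h0
  rw [hR] at he
  simpa [mul_comp] using he

lemma monic_natDegree_of_quadratic_mul {R S : ℝ[X]} {c : ℝ} {n : ℕ}
    (hR : R = (X ^ 2 + C c) * S) (hm : R.Monic) (hn : R.natDegree = n + 2) :
    S.Monic ∧ S.natDegree = n := by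
  have hq : (X ^ 2 + C c : ℝ[X]).Monic := monic_X_pow_add_C c two_ne_zero
  have hS : S.Monic := hq.of_mul_monic_left (hR ▸ hm)
  refine ⟨hS, ?_⟩
  rw [hR, hq.natDegree_mul hS, natDegree_X_pow_add_C] at hn
  omega

lemma X_dvd_of_comp_neg_X_eq_neg {R : ℝ[X]} (ho : R.comp (-X) = -R) : X ∣ R := by
  rw [X_dvd_iff, coeff_zero_eq_eval_zero]
  have h := congrArg (eval 0) ho
  simp only [eval_comp, eval_neg, eval_X, neg_zero] at h
  linarith

lemma X_sq_dvd_of_eval_zero {R : ℝ[X]} (he : R.comp (-X) = R) (h0 : R.eval 0 = 0) :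
    X ^ 2 + C 0 ∣ R := by
  obtain ⟨T, rfl⟩ : X ∣ R := by rwa [X_dvd_iff, coeff_zero_eq_eval_zero]
  have hT : T.comp (-X) = -T := by
    apply mul_left_cancel₀ (X_ne_zero (R := ℝ))
    have h := he
    simp only [mul_comp, X_comp] at h
    linear_combination -h
  obtain ⟨U, rfl⟩ := X_dvd_of_comp_neg_X_eq_neg hT
  exact ⟨U, by rw [C_0]; ring⟩

lemma aeval_neg_of_comp_neg_X {R : ℝ[X]} (he : R.comp (-X) = R) (z : ℂ) :
    aeval (-z) R = aeval z R := by
  conv_rhs => rw [← he]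
  simp [aeval_comp]

/-- An even monic real polynomial without roots in the open right half-plane is a product of
factors `X² + μ²`. -/
lemma exists_eq_prod_X_sq_add_sq (m : ℕ) : ∀ {R : ℝ[X]}, R.Monic → R.natDegree = 2 * m →
    R.comp (-X) = R → (∀ z : ℂ, 0 < z.re → aeval z R ≠ 0) →
    ∃ μ : ℕ → ℝ, R = ∏ i ∈ Finset.Icc 1 m, (X ^ 2 + C ((μ i) ^ 2)) := by
  induction m with
  | zero =>
    intro R hm hn _ _
    exact ⟨0, by simpa using hm.natDegree_eq_zero.mp (by simpa using hn)⟩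
  | succ m ih =>
    intro R hm hn he hz
    obtain ⟨z, hroot⟩ : ∃ z : ℂ, aeval z R = 0 :=
      IsAlgClosed.exists_aeval_eq_zero ℂ R (by
        rw [degree_eq_natDegree hm.ne_zero, hn]; norm_cast)
    have hre : z.re = 0 := by
      rcases lt_trichotomy z.re 0 with h | h | h
      · exact absurd ((aeval_neg_of_comp_neg_X he z).trans hroot) (hz (-z) (by simpa using h))
      · exact h
      · exact absurd hroot (hz z h)
    have hdvd : X ^ 2 + C (z.im ^ 2) ∣ R := by
      by_cases him : z.im = 0
      · have hz0 : z = 0 := Complex.ext hre him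
        subst hz0
        have h0 : R.eval 0 = 0 := by
          have h : aeval (((0 : ℝ) : ℂ)) R = 0 := by simpa using hroot
          rw [← Complex.coe_algebraMap, aeval_algebraMap_apply] at h
          simpa using h
        simpa using X_sq_dvd_of_eval_zero he h0
      · have h := R.quadratic_dvd_of_aeval_eq_zero_im_ne_zero hroot him
        have hnorm : ‖z‖ ^ 2 = z.im ^ 2 := by
          rw [Complex.sq_norm, Complex.normSq_apply, hre]; ring
        simpa [hre, hnorm] using h
    obtain ⟨S, hS⟩ := hdvd
    obtain ⟨hSm, hSn⟩ := monic_natDegree_of_quadratic_mul (n := 2 * m) hS hm (by omega)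
    obtain ⟨μ, hμ⟩ := ih hSm hSn (comp_neg_X_of_quadratic_mul hS he) (fun w hw h =>
      hz w hw (by rw [hS, map_mul, h, mul_zero]))
    refine ⟨Function.update μ (m + 1) z.im, ?_⟩
    rw [Finset.prod_Icc_succ_top (by omega), hS, hμ, mul_comm, Function.update_self]
    congr 1
    refine Finset.prod_congr rfl fun i hi => ?_
    rw [Function.update_of_ne (by have := (Finset.mem_Icc.mp hi).2; omega)]

/-- An even monic real polynomial with at most one root in the open right half-plane, counted with
multiplicity, is a product of factors `X² + μ²`, all but at most one, which is `X² - r²`. -/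
lemma exists_eq_prod_of_at_most_one_root {m : ℕ} {R : ℝ[X]} (hm : R.Monic)
    (hn : R.natDegree = 2 * (m + 1)) (he : R.comp (-X) = R)
    (hz : ∀ a b : ℂ, 0 < a.re → 0 < b.re →
      ¬ (X - C a) * (X - C b) ∣ R.map (algebraMap ℝ ℂ)) :
    ∃ μ : ℕ → ℝ,
      (∃ r : ℝ, R = (X ^ 2 - C (r ^ 2)) * ∏ i ∈ Finset.Icc 1 m, (X ^ 2 + C ((μ i) ^ 2))) ∨
        R = ∏ i ∈ Finset.Icc 1 (m + 1), (X ^ 2 + C ((μ i) ^ 2)) := by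
  by_cases hex : ∃ z : ℂ, 0 < z.re ∧ aeval z R = 0
  · obtain ⟨z, hpos, hroot⟩ := hex
    have him : z.im = 0 := by
      by_contra him
      exact hz _ _ (by simpa using hpos) hpos
        (R.mul_star_dvd_of_aeval_eq_zero_im_ne_zero hroot him)
    obtain ⟨r, rfl⟩ : ∃ r : ℝ, z = r := ⟨z.re, Complex.ext rfl (by simpa using him)⟩
    have hr : 0 < r := by simpa using hpos
    have hrr : R.IsRoot r := by
      rw [← Complex.coe_algebraMap, aeval_algebraMap_apply] at hroot
      simpa using hroot
    have hrn : R.IsRoot (-r) := by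
      have h := congrArg (eval r) he
      rw [eval_comp, eval_neg, eval_X] at h
      rw [IsRoot, h, hrr]
    have hfac : (X - C r) * (X - C (-r)) = (X ^ 2 + C (-r ^ 2) : ℝ[X]) := by
      simp only [map_neg, map_pow]; ring
    have hdvd : X ^ 2 + C (-r ^ 2) ∣ R := by
      rw [← hfac]
      refine IsCoprime.mul_dvd ?_ (dvd_iff_isRoot.mpr hrr) (dvd_iff_isRoot.mpr hrn)
      exact isCoprime_X_sub_C_of_isUnit_sub (IsUnit.mk0 _ (by linarith))
    obtain ⟨S, hS⟩ := hdvd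
    obtain ⟨hSm, hSn⟩ := monic_natDegree_of_quadratic_mul (n := 2 * m) hS hm (by omega)
    obtain ⟨μ, hμ⟩ := exists_eq_prod_X_sq_add_sq m hSm hSn (comp_neg_X_of_quadratic_mul hS he)
      (fun w hw h => by
        refine hz r w hpos hw ?_
        rw [hS, ← hfac, Polynomial.map_mul, Polynomial.map_mul]
        refine mul_dvd_mul (by simp) ?_
        rw [dvd_iff_isRoot, IsRoot, eval_map_algebraMap, h])
    refine ⟨μ, Or.inl ⟨r, ?_⟩⟩
    rw [← hμ, hS, map_neg, sub_eq_add_neg]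
  · push Not at hex
    obtain ⟨μ, hμ⟩ := exists_eq_prod_X_sq_add_sq (m + 1) hm hn he hex
    exact ⟨μ, Or.inr hμ⟩

lemma exists_eq_X_sq_sub_sq_mul_prod {m : ℕ} {R : ℝ[X]} (hm : R.Monic)
    (hn : R.natDegree = 2 * (m + 1)) (he : R.comp (-X) = R)
    (hz : ∀ a b : ℂ, 0 < a.re → 0 < b.re →
      ¬ (X - C a) * (X - C b) ∣ R.map (algebraMap ℝ ℂ)) (h0 : R.eval 0 ≤ 0) :
    ∃ (r : ℝ) (μ : ℕ → ℝ),
      R = (X ^ 2 - C (r ^ 2)) * ∏ i ∈ Finset.Icc 1 m, (X ^ 2 + C ((μ i) ^ 2)) := by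
  obtain ⟨μ, ⟨r, h⟩ | h⟩ := exists_eq_prod_of_at_most_one_root hm hn he hz
  · exact ⟨r, μ, h⟩
  have hnn : 0 ≤ R.eval 0 := by
    rw [h, eval_prod]
    exact Finset.prod_nonneg fun i _ => by simp [sq_nonneg]
  obtain ⟨S, hS⟩ := X_sq_dvd_of_eval_zero he (le_antisymm h0 hnn)
  obtain ⟨hSm, hSn⟩ := monic_natDegree_of_quadratic_mul (n := 2 * m) hS hm (by omega)
  obtain ⟨ν, hν⟩ := exists_eq_prod_X_sq_add_sq m hSm hSn (comp_neg_X_of_quadratic_mul hS he)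
    (fun w hw hw0 => by
      have hR : aeval w R = 0 := by rw [hS, map_mul, hw0, mul_zero]
      rw [h, map_prod, Finset.prod_eq_zero_iff] at hR
      obtain ⟨i, -, hi⟩ := hR
      simp only [map_add, map_pow, aeval_X, aeval_C, Complex.coe_algebraMap] at hi
      have hre := congrArg Complex.re hi
      have him := congrArg Complex.im hi
      simp only [pow_two, Complex.add_re, Complex.add_im, Complex.mul_re, Complex.mul_im,
        Complex.ofReal_re, Complex.ofReal_im, Complex.zero_re, Complex.zero_im] at hre him
      have hwi : w.im = 0 := by
        have : w.re * w.im = 0 := by linarith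
        exact (mul_eq_zero.mp this).resolve_left hw.ne'
      rw [hwi] at hre
      nlinarith [mul_pos hw hw, mul_self_nonneg (μ i)])
  refine ⟨0, ν, ?_⟩
  rw [← hν, hS]
  simp

lemma exists_eq_X_sq_add_C_mul_prod {m : ℕ} {R : ℝ[X]} (hm : R.Monic)
    (hn : R.natDegree = 2 * (m + 1)) (he : R.comp (-X) = R)
    (hz : ∀ a b : ℂ, 0 < a.re → 0 < b.re →
      ¬ (X - C a) * (X - C b) ∣ R.map (algebraMap ℝ ℂ)) :
    ∃ (σ : ℝ) (μ : ℕ → ℝ),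
      R = (X ^ 2 + C σ) * ∏ i ∈ Finset.Icc 1 m, (X ^ 2 + C ((μ i) ^ 2)) := by
  obtain ⟨μ, ⟨r, h⟩ | h⟩ := exists_eq_prod_of_at_most_one_root hm hn he hz
  · exact ⟨-r ^ 2, μ, by rw [h, map_neg, sub_eq_add_neg]⟩
  · exact ⟨μ (m + 1) ^ 2, μ, by rw [h, Finset.prod_Icc_succ_top (by omega), mul_comm]⟩

/-- A monic real polynomial that is negative at `0` has a positive root. -/
lemma exists_pos_root_of_eval_zero_neg {P : ℝ[X]} (hm : P.Monic) (h0 : P.eval 0 < 0) :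
    ∃ t : ℝ, 0 < t ∧ P.eval t = 0 := by
  have hdeg : 0 < P.degree := by
    by_contra hd
    have h1 : P = 1 := hm.degree_le_zero_iff_eq_one.mp (not_lt.mp hd)
    rw [h1, eval_one] at h0
    linarith
  have ht := P.tendsto_atTop_of_leadingCoeff_nonneg hdeg (by rw [hm.leadingCoeff]; norm_num)
  obtain ⟨b, hb0, hb⟩ := ((Filter.eventually_gt_atTop (0 : ℝ)).and
    (ht.eventually_gt_atTop 0)).exists
  obtain ⟨t, ht, hPt⟩ := intermediate_value_Ioo hb0.le P.continuousOn ⟨h0, hb⟩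
  exact ⟨t, ht.1, hPt⟩

/-! ### Two roots of a characteristic polynomial -/

lemma Module.End.exists_triangular_pair {V : Type*} [AddCommGroup V] [Module ℂ V]
    [FiniteDimensional ℂ V] (f : Module.End ℂ V) {a b : ℂ}
    (h : (X - C a) * (X - C b) ∣ LinearMap.charpoly f) :
    ∃ (v w : V) (c : ℂ), v ≠ 0 ∧ w ∉ Submodule.span ℂ {v} ∧
      f v = a • v ∧ f w = b • w + c • v := by
  have ha : (LinearMap.charpoly f).IsRoot a := dvd_iff_isRoot.mp (dvd_of_mul_right_dvd h)
  have hb : (LinearMap.charpoly f).IsRoot b := dvd_iff_isRoot.mp (dvd_of_mul_left_dvd h)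
  obtain ⟨v, hv⟩ := ((Module.End.hasEigenvalue_iff_isRoot_charpoly f a).mpr ha).exists_hasEigenvector
  have hva : f v = a • v := hv.apply_eq_smul
  by_cases hab : a = b
  · subst hab
    have hrank : 2 ≤ Module.finrank ℂ (f.maxGenEigenspace a) := by
      rw [LinearMap.finrank_maxGenEigenspace_eq,
        le_rootMultiplicity_iff (LinearMap.charpoly_monic f).ne_zero, pow_two]
      exact h
    obtain ⟨u, hu, huv⟩ : ∃ u ∈ f.maxGenEigenspace a, u ∉ Submodule.span ℂ {v} := by
      by_contra! hle
      have h1 := Submodule.finrank_mono (show f.maxGenEigenspace a ≤ Submodule.span ℂ {v} from hle)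
      have h2 := finrank_span_singleton (K := ℂ) hv.2
      omega
    classical
    have hk : ∃ k : ℕ, ((f - a • (1 : Module.End ℂ V)) ^ k) u ∈ Submodule.span ℂ {v} := by
      obtain ⟨k, hk⟩ := (f.mem_maxGenEigenspace a u).mp hu
      exact ⟨k, by rw [hk]; exact zero_mem _⟩
    obtain ⟨j, hj⟩ : ∃ j, Nat.find hk = j + 1 := by
      refine Nat.exists_eq_succ_of_ne_zero fun h0 => huv ?_
      have := Nat.find_spec hk
      rwa [h0, pow_zero, Module.End.one_apply] at this
    have hs := Nat.find_spec hk
    rw [hj, pow_succ', Module.End.mul_apply] at hs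
    obtain ⟨c, hc⟩ := Submodule.mem_span_singleton.mp hs
    refine ⟨v, ((f - a • (1 : Module.End ℂ V)) ^ j) u, c, hv.2,
      Nat.find_min hk (by omega), hva, ?_⟩
    rw [hc]
    simp
  · obtain ⟨w, hw⟩ :=
      ((Module.End.hasEigenvalue_iff_isRoot_charpoly f b).mpr hb).exists_hasEigenvector
    have hwb : f w = b • w := hw.apply_eq_smul
    refine ⟨v, w, 0, hv.2, fun hmem => ?_, hva, by simpa using hwb⟩
    obtain ⟨c, rfl⟩ := Submodule.mem_span_singleton.mp hmem
    rw [map_smul, hva, smul_comm b c v, ← sub_eq_zero, ← smul_sub, ← sub_smul, smul_smul] at hwb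
    have hc : c ≠ 0 := fun hc => hw.2 (by rw [hc, zero_smul])
    exact smul_ne_zero (mul_ne_zero hc (sub_ne_zero.mpr hab)) hv.2 hwb

/-! ### The Minkowski form in matrix language -/

/-- The diagonal entries of the Minkowski metric. -/
def minkSign (d : ℕ) (i : Fin d) : ℝ := if (i : ℕ) = 0 then -1 else 1

lemma minkSign_mul_self (d : ℕ) (i : Fin d) : minkSign d i * minkSign d i = 1 := by
  unfold minkSign; split_ifs <;> norm_num

lemma diagonal_minkSign_mul_self (d : ℕ) :
    Matrix.diagonal (minkSign d) * Matrix.diagonal (minkSign d) = 1 := by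
  simp [Matrix.diagonal_mul_diagonal, minkSign_mul_self]

lemma det_diagonal_minkSign {d : ℕ} (hd : 0 < d) :
    (Matrix.diagonal (minkSign d)).det = -1 := by
  obtain ⟨n, rfl⟩ := Nat.exists_eq_succ_of_ne_zero hd.ne'
  rw [Matrix.det_diagonal, Fin.prod_univ_succ]
  simp [minkSign]

lemma IsSkew.transpose_mul_diagonal {d : ℕ} {F : (Fin d → ℝ) →ₗ[ℝ] (Fin d → ℝ)}
    (hF : IsSkew d F) :
    (LinearMap.toMatrix' F)ᵀ * Matrix.diagonal (minkSign d) =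
      -(Matrix.diagonal (minkSign d) * LinearMap.toMatrix' F) := by
  ext i j
  have h := hF (Pi.single i 1) (Pi.single j 1)
  simp only [mink, Pi.single_apply, mul_ite, mul_one, mul_zero, ite_mul, zero_mul, one_mul,
    Finset.sum_ite_eq', Finset.mem_univ, if_true] at h
  rw [Matrix.mul_diagonal, Matrix.neg_apply, Matrix.diagonal_mul, Matrix.transpose_apply,
    LinearMap.toMatrix'_apply, LinearMap.toMatrix'_apply]
  unfold minkSign
  split_ifs at h ⊢ <;> simp_all

lemma charpoly_comp_neg_X_of_transpose {n : Type*} [Fintype n] [DecidableEq n]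
    {A D : Matrix n n ℝ} (hD : D * D = 1) (hA : Aᵀ * D = -(D * A)) :
    A.charpoly.comp (-X) = (-1) ^ Fintype.card n * A.charpoly := by
  refine Polynomial.funext fun t => ?_
  have hT : Aᵀ = -(D * A * D) := by
    rw [← neg_mul, ← hA, Matrix.mul_assoc, hD, Matrix.mul_one]
  have hconj : (Matrix.scalar n (-t) - A)ᵀ = -(D * (Matrix.scalar n t - A) * D) := by
    rw [Matrix.transpose_sub, hT, Matrix.mul_sub, Matrix.sub_mul,
      ← (Matrix.scalar_commute t (fun r => mul_comm t r) D).eq, Matrix.mul_assoc _ D D, hD]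
    rw [Matrix.mul_one, Matrix.scalar_apply, Matrix.scalar_apply, Matrix.diagonal_transpose,
      ← Matrix.diagonal_neg]
    abel
  have hDD : D.det * D.det = 1 := by rw [← Matrix.det_mul, hD, Matrix.det_one]
  rw [eval_comp, eval_neg, eval_X, Matrix.eval_charpoly, ← Matrix.det_transpose, hconj,
    Matrix.det_neg, Matrix.det_mul, Matrix.det_mul, eval_mul, Matrix.eval_charpoly]
  simp only [eval_pow, eval_neg, eval_one]
  linear_combination (-1) ^ Fintype.card n * (Matrix.scalar n t - A).det * hDD

/-- A real skew-symmetric matrix of even size has nonnegative determinant. -/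
lemma det_nonneg_of_transpose_eq_neg {n : Type*} [Fintype n] [DecidableEq n]
    {S : Matrix n n ℝ} (hS : Sᵀ = -S) (hn : Even (Fintype.card n)) : 0 ≤ S.det := by
  by_contra! hlt
  have h0 : S.charpoly.eval 0 < 0 := by
    rw [Matrix.eval_charpoly, map_zero, zero_sub, Matrix.det_neg, hn.neg_one_pow, one_mul]
    exact hlt
  obtain ⟨t, ht, hroot⟩ := exists_pos_root_of_eval_zero_neg S.charpoly_monic h0
  rw [Matrix.eval_charpoly] at hroot
  obtain ⟨v, hv, hSv⟩ := Matrix.exists_mulVec_eq_zero_iff.mpr hroot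
  rw [Matrix.sub_mulVec, sub_eq_zero] at hSv
  have hts : Matrix.scalar n t *ᵥ v = t • v := by
    ext i; simp [Matrix.scalar_apply, Matrix.mulVec_diagonal]
  have h1 : v ⬝ᵥ (S *ᵥ v) = t * (v ⬝ᵥ v) := by rw [← hSv, hts, dotProduct_smul, smul_eq_mul]
  have h2 : v ⬝ᵥ (S *ᵥ v) = -(v ⬝ᵥ (S *ᵥ v)) := by
    nth_rewrite 1 [Matrix.dotProduct_mulVec, ← Matrix.mulVec_transpose, hS, Matrix.neg_mulVec,
      neg_dotProduct, dotProduct_comm]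
    rfl
  have h3 : t * (v ⬝ᵥ v) = 0 := by linarith
  exact hv (dotProduct_self_eq_zero.mp ((mul_eq_zero.mp h3).resolve_left ht.ne'))

/-! ### The Hermitian Minkowski form -/

/-- The sesquilinear extension of the Minkowski form to `ℂ^d`. -/
noncomputable def minkHerm (d : ℕ) (x y : Fin d → ℂ) : ℂ :=
  star x ⬝ᵥ (Matrix.diagonal (fun i => (minkSign d i : ℂ)) *ᵥ y)

lemma minkHerm_add_left {d : ℕ} (x y z : Fin d → ℂ) :
    minkHerm d (x + y) z = minkHerm d x z + minkHerm d y z := by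
  simp [minkHerm, add_dotProduct]

lemma minkHerm_add_right {d : ℕ} (x y z : Fin d → ℂ) :
    minkHerm d x (y + z) = minkHerm d x y + minkHerm d x z := by
  simp [minkHerm, Matrix.mulVec_add, dotProduct_add]

lemma minkHerm_smul_left {d : ℕ} (c : ℂ) (x y : Fin d → ℂ) :
    minkHerm d (c • x) y = star c * minkHerm d x y := by
  simp [minkHerm, star_smul, smul_dotProduct]

lemma minkHerm_smul_right {d : ℕ} (c : ℂ) (x y : Fin d → ℂ) :
    minkHerm d x (c • y) = c * minkHerm d x y := by
  simp [minkHerm, Matrix.mulVec_smul, dotProduct_smul]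

lemma star_minkHerm {d : ℕ} (x y : Fin d → ℂ) : star (minkHerm d x y) = minkHerm d y x := by
  simp only [minkHerm, dotProduct, Matrix.mulVec_diagonal, star_sum, star_mul', Pi.star_apply,
    Complex.star_def, Complex.conj_conj, Complex.conj_ofReal]
  exact Finset.sum_congr rfl fun i _ => by ring

lemma IsSkew.minkHerm_mulVec {d : ℕ} {F : (Fin d → ℝ) →ₗ[ℝ] (Fin d → ℝ)} (hF : IsSkew d F)
    (x y : Fin d → ℂ) :
    minkHerm d ((LinearMap.toMatrix' F).map (algebraMap ℝ ℂ) *ᵥ x) y =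
      -minkHerm d x ((LinearMap.toMatrix' F).map (algebraMap ℝ ℂ) *ᵥ y) := by
  have h := congrArg (fun B : Matrix (Fin d) (Fin d) ℝ => B.map (algebraMap ℝ ℂ))
    hF.transpose_mul_diagonal
  have hneg (B : Matrix (Fin d) (Fin d) ℝ) :
      (-B).map (algebraMap ℝ ℂ) = -B.map (algebraMap ℝ ℂ) := by ext; simp
  simp only [hneg, Matrix.map_mul, Matrix.diagonal_map (map_zero (algebraMap ℝ ℂ))] at h
  have hstar : ((LinearMap.toMatrix' F).map (algebraMap ℝ ℂ))ᴴ =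
      (LinearMap.toMatrix' F)ᵀ.map (algebraMap ℝ ℂ) := by
    ext; simp
  have hdiag : (Matrix.diagonal fun i => (minkSign d i : ℂ)) =
      Matrix.diagonal (⇑(algebraMap ℝ ℂ) ∘ minkSign d) := rfl
  rw [minkHerm, minkHerm, Matrix.star_mulVec, ← Matrix.dotProduct_mulVec, Matrix.mulVec_mulVec,
    Matrix.mulVec_mulVec, hstar, hdiag, ← dotProduct_neg, ← Matrix.neg_mulVec]
  exact congrArg (fun B => star x ⬝ᵥ (B *ᵥ y)) h

open scoped ComplexOrder in
lemma eq_zero_of_minkHerm_self {d : ℕ} {x : Fin d → ℂ} (hd : 0 < d) (h0 : x ⟨0, hd⟩ = 0)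
    (hx : minkHerm d x x = 0) : x = 0 := by
  refine dotProduct_star_self_eq_zero.mp ?_
  rw [dotProduct_comm, ← hx, minkHerm]
  refine Finset.sum_congr rfl fun i _ => ?_
  rw [Matrix.mulVec_diagonal]
  by_cases hi : (i : ℕ) = 0
  · have : i = ⟨0, hd⟩ := Fin.ext hi
    simp [this, h0]
  · simp [minkSign, hi, mul_comm]

/-- Counted with multiplicity, a skew-symmetric endomorphism of Minkowski space has at most one
eigenvalue with positive real part. -/
lemma IsSkew.not_dvd_charpoly {d : ℕ} {F : (Fin d → ℝ) →ₗ[ℝ] (Fin d → ℝ)} (hF : IsSkew d F)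
    (hd : 0 < d) {a b : ℂ} (ha : 0 < a.re) (hb : 0 < b.re) :
    ¬ (X - C a) * (X - C b) ∣ (LinearMap.charpoly F).map (algebraMap ℝ ℂ) := by
  intro hdvd
  set M := (LinearMap.toMatrix' F).map (algebraMap ℝ ℂ) with hM
  have hchar : (LinearMap.charpoly F).map (algebraMap ℝ ℂ) = (Matrix.toLin' M).charpoly := by
    rw [Matrix.charpoly_toLin', hM, Matrix.charpoly_map, ← Matrix.charpoly_toLin',
      Matrix.toLin'_toMatrix']
  rw [hchar] at hdvd
  obtain ⟨v, w, c, hv, hw, hMv, hMw⟩ := Module.End.exists_triangular_pair _ hdvd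
  rw [Matrix.toLin'_apply] at hMv hMw
  have hpos {z : ℂ} (hz : 0 < z.re) : z ≠ 0 := by rintro rfl; simp at hz
  have hvv : minkHerm d v v = 0 := by
    have h := hF.minkHerm_mulVec v v
    rw [← hM, hMv, minkHerm_smul_left, minkHerm_smul_right] at h
    have h' : (star a + a) * minkHerm d v v = 0 := by linear_combination h
    exact (mul_eq_zero.mp h').resolve_left (hpos (by simpa using by linarith))
  have hvw : minkHerm d v w = 0 := by
    have h := hF.minkHerm_mulVec v w
    rw [← hM, hMv, hMw, minkHerm_smul_left, minkHerm_add_right, minkHerm_smul_right,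
      minkHerm_smul_right, hvv] at h
    have h' : (star a + b) * minkHerm d v w = 0 := by linear_combination h
    exact (mul_eq_zero.mp h').resolve_left (hpos (by simpa using by linarith))
  have hwv : minkHerm d w v = 0 := by rw [← star_minkHerm, hvw, star_zero]
  have hww : minkHerm d w w = 0 := by
    have h := hF.minkHerm_mulVec w w
    rw [← hM, hMw, minkHerm_add_left, minkHerm_add_right, minkHerm_smul_left, minkHerm_smul_left,
      minkHerm_smul_right, minkHerm_smul_right, hvw, hwv] at h
    have h' : (star b + b) * minkHerm d w w = 0 := by linear_combination h
    exact (mul_eq_zero.mp h').resolve_left (hpos (by simpa using by linarith))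
  have hv0 : v ⟨0, hd⟩ ≠ 0 := fun h => hv (eq_zero_of_minkHerm_self hd h hvv)
  have hx : w + (-(w ⟨0, hd⟩ / v ⟨0, hd⟩)) • v = 0 := by
    refine eq_zero_of_minkHerm_self hd ?_ ?_
    · simp [hv0]
    · simp only [minkHerm_add_left, minkHerm_add_right, minkHerm_smul_left, minkHerm_smul_right,
        hvv, hvw, hwv, hww, mul_zero, add_zero]
  refine hw (Submodule.mem_span_singleton.mpr ⟨w ⟨0, hd⟩ / v ⟨0, hd⟩, ?_⟩)
  rw [neg_smul, ← sub_eq_add_neg, sub_eq_zero] at hx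
  exact hx.symm

lemma IsSkew.charpoly_comp_neg_X {d : ℕ} {F : (Fin d → ℝ) →ₗ[ℝ] (Fin d → ℝ)}
    (hF : IsSkew d F) :
    (LinearMap.charpoly F).comp (-X) = (-1) ^ d * LinearMap.charpoly F := by
  have h := charpoly_comp_neg_X_of_transpose (diagonal_minkSign_mul_self d)
    hF.transpose_mul_diagonal
  rwa [← Matrix.charpoly_toLin', Matrix.toLin'_toMatrix', Fintype.card_fin] at h

lemma IsSkew.eval_zero_charpoly_nonpos {d : ℕ} {F : (Fin d → ℝ) →ₗ[ℝ] (Fin d → ℝ)}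
    (hF : IsSkew d F) (hd : 0 < d) (he : Even d) : (LinearMap.charpoly F).eval 0 ≤ 0 := by
  have hS : (Matrix.diagonal (minkSign d) * LinearMap.toMatrix' F)ᵀ =
      -(Matrix.diagonal (minkSign d) * LinearMap.toMatrix' F) := by
    rw [Matrix.transpose_mul, Matrix.diagonal_transpose, hF.transpose_mul_diagonal]
  have h := det_nonneg_of_transpose_eq_neg hS (by simpa using he)
  rw [Matrix.det_mul, det_diagonal_minkSign hd] at h
  rw [← Matrix.toLin'_toMatrix' F, Matrix.charpoly_toLin', Matrix.eval_charpoly, map_zero,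
    zero_sub, Matrix.det_neg, Fintype.card_fin, he.neg_one_pow]
  linarith

/-- Factorization of the characteristic polynomial of a skew-symmetric
endomorphism of `𝕄^{1,d-1}`: for `d` even,
`P_F = (X² - μ_t²)(X² + μ_s²)·∏ᵢ(X² + μᵢ²)`; for `d` odd,
`P_F = X(X² + σ)·∏ᵢ(X² + μᵢ²)`. -/
theorem stmt12 (d : ℕ)
    (F : (Fin d → ℝ) →ₗ[ℝ] (Fin d → ℝ)) (hF : IsSkew d F) :
    (4 ≤ d → d % 2 = 0 →
      ∃ (μt μs : ℝ) (μ : ℕ → ℝ),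
        LinearMap.charpoly F =
          (X ^ 2 - C (μt ^ 2)) * (X ^ 2 + C (μs ^ 2)) *
            ∏ i ∈ Finset.Icc 1 (d / 2 - 2), (X ^ 2 + C ((μ i) ^ 2))) ∧
    (3 ≤ d → d % 2 = 1 →
      ∃ (σ : ℝ) (μ : ℕ → ℝ),
        LinearMap.charpoly F =
          X * (X ^ 2 + C σ) *
            ∏ i ∈ Finset.Icc 1 ((d - 3) / 2), (X ^ 2 + C ((μ i) ^ 2))) := by
  have hdeg : (LinearMap.charpoly F).natDegree = d := by
    rw [LinearMap.charpoly_natDegree, Module.finrank_fin_fun]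
  have hmon := LinearMap.charpoly_monic F
  constructor
  · intro hd hpar
    have hev : Even d := Nat.even_iff.mpr hpar
    obtain ⟨m, hm⟩ : ∃ m, d / 2 - 2 = m := ⟨_, rfl⟩
    have he := hF.charpoly_comp_neg_X
    rw [hev.neg_one_pow, one_mul] at he
    obtain ⟨r, μ, h⟩ := exists_eq_X_sq_sub_sq_mul_prod (m := m + 1) hmon (by omega) he
      (fun a b => hF.not_dvd_charpoly (by omega)) (hF.eval_zero_charpoly_nonpos (by omega) hev)
    refine ⟨r, μ (m + 1), μ, ?_⟩
    rw [h, hm, Finset.prod_Icc_succ_top (by omega)]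
    ring
  · intro hd hpar
    obtain ⟨m, hm⟩ : ∃ m, (d - 3) / 2 = m := ⟨_, rfl⟩
    have ho := hF.charpoly_comp_neg_X
    rw [(Nat.odd_iff.mpr hpar).neg_one_pow, neg_one_mul] at ho
    obtain ⟨R, hR⟩ := X_dvd_of_comp_neg_X_eq_neg ho
    have hRm : R.Monic := monic_X.of_mul_monic_left (hR ▸ hmon)
    have hRn : R.natDegree = 2 * (m + 1) := by
      rw [hR, monic_X.natDegree_mul hRm, natDegree_X] at hdeg
      omega
    have hRe : R.comp (-X) = R := by
      apply mul_left_cancel₀ (X_ne_zero (R := ℝ))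
      rw [hR] at ho
      simp only [mul_comp, X_comp] at ho
      linear_combination -ho
    obtain ⟨σ, μ, h⟩ := exists_eq_X_sq_add_C_mul_prod hRm hRn hRe (fun a b ha hb hdvd =>
      hF.not_dvd_charpoly (by omega) ha hb
        (by rw [hR, Polynomial.map_mul]; exact hdvd.mul_left _))
    exact ⟨σ, μ, by rw [hR, hm, h, mul_assoc]⟩
end
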